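/- Let β_cr ∈ (π, 2π) be the critical angle for planar sectors, i.e. β_cr = sup{β ∈ [π, 2π] : H(Λ_β) = 1/4}, where H(Λ_β) is the L² Hardy constant of the sector Λ_β = {(r cos θ, r sin θ) : r > 0, 0 < θ < β}. Then β_cr is the unique solution in the interval (π, 2π) of the equation tan((β − π)/4) = 4 (Γ(3/4)/Γ(1/4))². -/

import Mathlib

open MeasureTheory Real

/-- The infinite planar sector of angle `β`. -/
def sector (β : ℝ) : Set (EuclideanSpace ℝ (Fin 2)) :=
  {p | ∃ r θ : ℝ, 0 < r ∧ 0 < θ ∧ θ < β ∧ p 0 = r * Real.cos θ ∧ p 1 = r * Real.sin θ}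

/-- The `L²` Hardy constant of an open set `Ω ⊆ ℝⁿ`: the supremum of constants `c ≥ 0`
such that `∫_Ω ‖∇u‖² ≥ c ∫_Ω u²/d²` for all `u ∈ C_c^∞(Ω)`, where `d(x) = dist(x, Ωᶜ)`. -/
noncomputable def hardyConst {n : ℕ} (Ω : Set (EuclideanSpace ℝ (Fin n))) : ℝ :=
  sSup {c : ℝ | 0 ≤ c ∧ ∀ u : EuclideanSpace ℝ (Fin n) → ℝ,
    ContDiff ℝ (⊤ : ℕ∞) u → HasCompactSupport u → tsupport u ⊆ Ω →
    c * ∫ x in Ω, u x ^ 2 / Metric.infDist x Ωᶜ ^ 2 ≤ ∫ x in Ω, ‖gradient u x‖ ^ 2}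

/-- A power series with polynomially bounded coefficients converges absolutely in `(-1, 1)`. -/
lemma summable_coeff_mul_pow {c : ℕ → ℝ} {C : ℝ} {k : ℕ} (hc : ∀ n, |c n| ≤ C * ((n : ℝ) + 1) ^ k)
    {x : ℝ} (hx : |x| < 1) : Summable fun n => c n * x ^ n := by
  obtain ⟨r, hr1, hr2⟩ := exists_between hx
  have hr0 : 0 < r := (abs_nonneg x).trans_lt hr1
  have hs : Summable fun n : ℕ => C / r * (((n + 1 : ℕ) : ℝ) ^ k * r ^ (n + 1)) := by
    refine Summable.mul_left _ ?_
    exact (summable_nat_add_iff 1).2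
      (summable_pow_mul_geometric_of_norm_lt_one (R := ℝ) k (by rwa [Real.norm_of_nonneg hr0.le]))
  refine Summable.of_norm_bounded hs fun n => ?_
  rw [Real.norm_eq_abs, abs_mul, abs_pow]
  have h1 : |x| ^ n ≤ r ^ n := pow_le_pow_left₀ (abs_nonneg x) hr1.le n
  calc |c n| * |x| ^ n ≤ C * ((n : ℝ) + 1) ^ k * r ^ n :=
        mul_le_mul (hc n) h1 (by positivity) ((abs_nonneg _).trans (hc n))
    _ = _ := by push_cast; field_simp; ring

lemma hasDerivAt_tsum_coeff_mul_pow {c : ℕ → ℝ} {C : ℝ} {k : ℕ}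
    (hc : ∀ n, |c n| ≤ C * ((n : ℝ) + 1) ^ k) {x : ℝ} (hx : |x| < 1) :
    HasDerivAt (fun y => ∑' n, c n * y ^ n) (∑' n : ℕ, ((n : ℝ) + 1) * c (n + 1) * x ^ n) x := by
  obtain ⟨r, hr1, hr2⟩ := exists_between hx
  have hr0 : 0 < r := (abs_nonneg x).trans_lt hr1
  have hs : Summable fun n : ℕ => C / r ^ 2 * (((n + 1 : ℕ) : ℝ) ^ (k + 1) * r ^ (n + 1)) := by
    refine Summable.mul_left _ ?_
    exact (summable_nat_add_iff 1).2
      (summable_pow_mul_geometric_of_norm_lt_one (R := ℝ) (k + 1)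
        (by rwa [Real.norm_of_nonneg hr0.le]))
  have hbound : ∀ (n : ℕ) (y : ℝ), y ∈ Metric.ball (0 : ℝ) r →
      ‖c n * ((n : ℝ) * y ^ (n - 1))‖ ≤ C / r ^ 2 * (((n + 1 : ℕ) : ℝ) ^ (k + 1) * r ^ (n + 1)) := by
    intro n y hy
    rw [mem_ball_zero_iff, Real.norm_eq_abs] at hy
    have hC : 0 ≤ C * ((n : ℝ) + 1) ^ k := (abs_nonneg _).trans (hc n)
    rcases n with _ | n
    · have : 0 ≤ C := by simpa using hC
      simp only [Nat.cast_zero, zero_mul, mul_zero, norm_zero]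
      positivity
    · rw [Real.norm_eq_abs, abs_mul, abs_mul, abs_pow, Nat.abs_cast, Nat.add_sub_cancel]
      have h1 : |y| ^ n ≤ r ^ n := pow_le_pow_left₀ (abs_nonneg y) hy.le n
      have h2 : ((n + 1 : ℕ) : ℝ) * |y| ^ n ≤ (((n + 1 : ℕ) : ℝ) + 1) * r ^ n := by
        apply mul_le_mul _ h1 (by positivity) (by positivity)
        linarith
      calc _ ≤ C * (((n + 1 : ℕ) : ℝ) + 1) ^ k * ((((n + 1 : ℕ) : ℝ) + 1) * r ^ n) :=
            mul_le_mul (hc _) h2 (by positivity) hC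
        _ = _ := by push_cast; field_simp; ring
  have key := hasDerivAt_tsum_of_isPreconnected (𝕜 := ℝ) (F := ℝ) hs
    (Metric.isOpen_ball (x := (0 : ℝ)) (ε := r))
    (convex_ball (0 : ℝ) r).isPreconnected
    (g := fun n y => c n * y ^ n) (g' := fun n y => c n * ((n : ℝ) * y ^ (n - 1)))
    (fun n y _ => (hasDerivAt_pow n y).const_mul (c n)) hbound
    (y₀ := 0) (by simpa using hr0) (by
      refine summable_of_ne_finset_zero (s := {0}) fun n hn => ?_
      have : n ≠ 0 := by simpa using hn
      simp [this]) (y := x) (by simpa using hr1)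
  have hsum : Summable fun n : ℕ => c n * ((n : ℝ) * x ^ (n - 1)) :=
    Summable.of_norm_bounded hs fun n => hbound n x (by simpa using hr1)
  have e : ∑' n : ℕ, ((n : ℝ) + 1) * c (n + 1) * x ^ n
      = ∑' n : ℕ, c n * ((n : ℝ) * x ^ (n - 1)) := by
    rw [hsum.tsum_eq_zero_add]
    simp only [Nat.cast_zero, zero_mul, mul_zero, zero_add, Nat.add_sub_cancel]
    refine tsum_congr fun n => ?_
    push_cast; ring
  rw [e]
  exact key

/-- Taylor coefficients at `0` of the solution `g` of `((1 - x²) g')' = g / 4` with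
`g 0 = 1` and `g' 0 = -κ`. -/
noncomputable def legendreCoeff (κ : ℝ) : ℕ → ℝ
  | 0 => 1
  | 1 => -κ
  | n + 2 => ((n : ℝ) + 1 / 2) ^ 2 / (((n : ℝ) + 1) * ((n : ℝ) + 2)) * legendreCoeff κ n

lemma abs_legendreCoeff_le (κ : ℝ) : ∀ n, |legendreCoeff κ n| ≤ 1 + |κ|
  | 0 => by simp [legendreCoeff]
  | 1 => by simp [legendreCoeff]
  | n + 2 => by
    have ih := abs_legendreCoeff_le κ n
    rw [legendreCoeff, abs_mul, abs_of_nonneg (by positivity)]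
    have : ((n : ℝ) + 1 / 2) ^ 2 / (((n : ℝ) + 1) * ((n : ℝ) + 2)) ≤ 1 := by
      rw [div_le_one (by positivity)]
      nlinarith [(Nat.cast_nonneg n : (0 : ℝ) ≤ n)]
    calc _ ≤ 1 * |legendreCoeff κ n| := by gcongr
      _ ≤ _ := by simpa using ih

/-- The solution of `((1 - x²) g')' = g / 4` on `(-1, 1)` with `g 0 = 1` and `g' 0 = -κ`. -/
noncomputable def legendreSol (κ x : ℝ) : ℝ := ∑' n, legendreCoeff κ n * x ^ n

/-- The derivative of `legendreSol`. -/
noncomputable def legendreSol' (κ x : ℝ) : ℝ :=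
  ∑' n : ℕ, ((n : ℝ) + 1) * legendreCoeff κ (n + 1) * x ^ n

/-- The second derivative of `legendreSol`. -/
noncomputable def legendreSol'' (κ x : ℝ) : ℝ :=
  ∑' n : ℕ, ((n : ℝ) + 1) * (((n + 1 : ℕ) : ℝ) + 1) * legendreCoeff κ (n + 1 + 1) * x ^ n

lemma hasDerivAt_legendreSol (κ : ℝ) {x : ℝ} (hx : |x| < 1) :
    HasDerivAt (legendreSol κ) (legendreSol' κ x) x :=
  hasDerivAt_tsum_coeff_mul_pow (C := 1 + |κ|) (k := 0)
    (fun n => by simpa using abs_legendreCoeff_le κ n) hx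

lemma abs_legendreCoeff'_le (κ : ℝ) (n : ℕ) :
    |((n : ℝ) + 1) * legendreCoeff κ (n + 1)| ≤ (1 + |κ|) * ((n : ℝ) + 1) ^ 1 := by
  rw [abs_mul, abs_of_nonneg (by positivity : (0 : ℝ) ≤ n + 1), pow_one, mul_comm]
  exact mul_le_mul_of_nonneg_right (abs_legendreCoeff_le κ _) (by positivity)

lemma hasDerivAt_legendreSol' (κ : ℝ) {x : ℝ} (hx : |x| < 1) :
    HasDerivAt (legendreSol' κ) (legendreSol'' κ x) x := by
  have := hasDerivAt_tsum_coeff_mul_pow (abs_legendreCoeff'_le κ) hx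
  have e : legendreSol'' κ x = ∑' n : ℕ, ((n : ℝ) + 1) *
      ((((n + 1 : ℕ) : ℝ) + 1) * legendreCoeff κ (n + 1 + 1)) * x ^ n :=
    tsum_congr fun n => by ring
  rw [e]
  exact this

lemma legendreSol_ode (κ : ℝ) {x : ℝ} (hx : |x| < 1) :
    (1 - x ^ 2) * legendreSol'' κ x = 2 * x * legendreSol' κ x + legendreSol κ x / 4 := by
  set c := legendreCoeff κ with hcdef
  have hb := abs_legendreCoeff_le κ
  have hC : 0 ≤ 1 + |κ| := by positivity
  have s0 : Summable fun n => c n * x ^ n :=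
    summable_coeff_mul_pow (C := 1 + |κ|) (k := 0) (fun n => by simpa using hb n) hx
  have s1 : Summable fun n : ℕ => ((n : ℝ) * c n) * x ^ n := by
    refine summable_coeff_mul_pow (C := 1 + |κ|) (k := 1) (fun n => ?_) hx
    rw [abs_mul, Nat.abs_cast, pow_one, mul_comm]
    exact mul_le_mul (hb n) (by linarith) (by positivity) hC
  have s2 : Summable fun n : ℕ => ((n : ℝ) * ((n : ℝ) - 1) * c n) * x ^ n := by
    refine summable_coeff_mul_pow (C := 1 + |κ|) (k := 2) (fun n => ?_) hx
    rw [abs_mul, mul_comm]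
    refine mul_le_mul (hb n) ?_ (by positivity) hC
    rw [abs_le]
    constructor <;> nlinarith [(Nat.cast_nonneg n : (0 : ℝ) ≤ n)]
  have e1 : x * legendreSol' κ x = ∑' n : ℕ, ((n : ℝ) * c n) * x ^ n := by
    rw [s1.tsum_eq_zero_add, legendreSol', ← tsum_mul_left]
    simp only [Nat.cast_zero, zero_mul, zero_add]
    exact tsum_congr fun n => by push_cast; ring
  have e2 : x ^ 2 * legendreSol'' κ x = ∑' n : ℕ, ((n : ℝ) * ((n : ℝ) - 1) * c n) * x ^ n := by
    rw [s2.tsum_eq_zero_add, ((summable_nat_add_iff 1).2 s2).tsum_eq_zero_add, legendreSol'',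
      ← tsum_mul_left]
    simp only [Nat.cast_zero, zero_mul, zero_add, Nat.cast_one, sub_self, mul_zero]
    exact tsum_congr fun n => by push_cast; ring
  have e3 : legendreSol'' κ x = ∑' n : ℕ, (((n : ℝ) * ((n : ℝ) - 1) * c n) * x ^ n
      + 2 * (((n : ℝ) * c n) * x ^ n) + 1 / 4 * (c n * x ^ n)) := by
    refine tsum_congr fun n => ?_
    rw [legendreCoeff]
    push_cast
    have h1 : (n : ℝ) + 1 ≠ 0 := by positivity
    have h2 : (n : ℝ) + 2 ≠ 0 := by positivity
    have h3 : (n : ℝ) + 1 + 1 ≠ 0 := by positivity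
    field_simp
    ring
  rw [((s2.add (s1.mul_left 2))).tsum_add (s0.mul_left _), s2.tsum_add (s1.mul_left 2),
    tsum_mul_left, tsum_mul_left, ← e1, ← e2] at e3
  have e4 : legendreSol κ x = ∑' n, c n * x ^ n := rfl
  rw [← e4] at e3
  linear_combination e3

lemma legendreSol_zero (κ : ℝ) : legendreSol κ 0 = 1 := by
  rw [legendreSol, tsum_eq_single 0 (fun n hn => by simp [hn])]
  simp [legendreCoeff]

lemma legendreSol'_zero (κ : ℝ) : legendreSol' κ 0 = -κ := by
  rw [legendreSol', tsum_eq_single 0 (fun n hn => by simp [hn])]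
  simp [legendreCoeff]

/-- The coefficients of the even solution. -/
noncomputable def evenCoeff : ℕ → ℝ
  | 0 => 1
  | n + 1 => ((n : ℝ) + 1 / 4) ^ 2 / (((n : ℝ) + 1 / 2) * ((n : ℝ) + 1)) * evenCoeff n

/-- The coefficients of the odd solution. -/
noncomputable def oddCoeff : ℕ → ℝ
  | 0 => 1
  | n + 1 => ((n : ℝ) + 3 / 4) ^ 2 / (((n : ℝ) + 1) * ((n : ℝ) + 3 / 2)) * oddCoeff n

lemma evenCoeff_pos : ∀ n, 0 < evenCoeff n
  | 0 => by simp [evenCoeff]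
  | n + 1 => by
    have := evenCoeff_pos n
    rw [evenCoeff]; positivity

lemma oddCoeff_pos : ∀ n, 0 < oddCoeff n
  | 0 => by simp [oddCoeff]
  | n + 1 => by
    have := oddCoeff_pos n
    rw [oddCoeff]; positivity

lemma legendreCoeff_two_mul (κ : ℝ) : ∀ n, legendreCoeff κ (2 * n) = evenCoeff n
  | 0 => by simp [evenCoeff, legendreCoeff]
  | n + 1 => by
    rw [show 2 * (n + 1) = 2 * n + 2 by ring, legendreCoeff, legendreCoeff_two_mul κ n, evenCoeff]
    congr 1
    push_cast
    field_simp
    ring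

lemma legendreCoeff_two_mul_add_one (κ : ℝ) : ∀ n, legendreCoeff κ (2 * n + 1) = -κ * oddCoeff n
  | 0 => by simp [oddCoeff, legendreCoeff]
  | n + 1 => by
    rw [show 2 * (n + 1) + 1 = 2 * n + 1 + 2 by ring, legendreCoeff,
      legendreCoeff_two_mul_add_one κ n, oddCoeff]
    push_cast
    field_simp
    ring

lemma evenCoeff_le_one (n : ℕ) : evenCoeff n ≤ 1 := by
  have := abs_legendreCoeff_le 0 (2 * n)
  rw [legendreCoeff_two_mul, abs_of_pos (evenCoeff_pos n)] at this
  simpa using this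

lemma oddCoeff_le_one : ∀ n, oddCoeff n ≤ 1
  | 0 => by simp [oddCoeff]
  | n + 1 => by
    rw [oddCoeff]
    have h := oddCoeff_le_one n
    have h0 := oddCoeff_pos n
    have : ((n : ℝ) + 3 / 4) ^ 2 / (((n : ℝ) + 1) * ((n : ℝ) + 3 / 2)) ≤ 1 := by
      rw [div_le_one (by positivity)]
      nlinarith [(Nat.cast_nonneg n : (0 : ℝ) ≤ n)]
    nlinarith

lemma le_oddCoeff : ∀ n : ℕ, 1 / (2 * ((n : ℝ) + 1 / 2)) ≤ oddCoeff n
  | 0 => by simp [oddCoeff]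
  | n + 1 => by
    rw [oddCoeff]
    have h := le_oddCoeff n
    calc 1 / (2 * (((n + 1 : ℕ) : ℝ) + 1 / 2))
        ≤ ((n : ℝ) + 3 / 4) ^ 2 / (((n : ℝ) + 1) * ((n : ℝ) + 3 / 2))
          * (1 / (2 * ((n : ℝ) + 1 / 2))) := by
          push_cast
          rw [div_mul_div_comm, mul_one, div_le_div_iff₀ (by positivity) (by positivity)]
          nlinarith [(Nat.cast_nonneg n : (0 : ℝ) ≤ n)]
      _ ≤ _ := by gcongr

lemma not_summable_oddCoeff : ¬ Summable oddCoeff := by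
  intro h
  have h1 : Summable fun n : ℕ => 1 / (2 * ((n : ℝ) + 1 / 2)) :=
    Summable.of_nonneg_of_le (fun n => by positivity) le_oddCoeff h
  have h2 : Summable fun n : ℕ => (1 / 2 : ℝ) * (1 / (((n + 1 : ℕ) : ℝ))) := by
    refine Summable.of_nonneg_of_le (fun n => by positivity) (fun n => ?_) h1
    push_cast
    rw [div_mul_div_comm, mul_one, div_le_div_iff₀ (by positivity) (by positivity)]
    linarith
  rw [summable_mul_left_iff (by norm_num)] at h2
  exact Real.not_summable_one_div_natCast ((summable_nat_add_iff 1).1 h2)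

lemma evenCoeff_div_oddCoeff_antitone : Antitone fun n => evenCoeff n / oddCoeff n := by
  refine antitone_nat_of_succ_le fun n => ?_
  have ha := evenCoeff_pos n
  have hb := oddCoeff_pos n
  rw [evenCoeff, oddCoeff, mul_div_mul_comm]
  have : ((n : ℝ) + 1 / 4) ^ 2 / (((n : ℝ) + 1 / 2) * ((n : ℝ) + 1)) /
      (((n : ℝ) + 3 / 4) ^ 2 / (((n : ℝ) + 1) * ((n : ℝ) + 3 / 2))) ≤ 1 := by
    rw [div_le_one (by positivity), div_le_div_iff₀ (by positivity) (by positivity)]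
    have hn : (0 : ℝ) ≤ n := Nat.cast_nonneg n
    have : 0 ≤ (n : ℝ) ^ 2 := by positivity
    nlinarith [mul_nonneg hn hn]
  have h0 : 0 < evenCoeff n / oddCoeff n := by positivity
  nlinarith

lemma evenCoeff_div_oddCoeff_eq (n : ℕ) (hn : n ≠ 0) :
    evenCoeff (n + 1) / oddCoeff (n + 1) = (Real.GammaSeq (3 / 4) n ^ 2 * Real.GammaSeq (1 / 2) n) /
      (Real.GammaSeq (1 / 4) n ^ 2 * Real.GammaSeq (3 / 2) n) := by
  have hn0 : (0 : ℝ) < n := by positivity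
  have key : ∀ m : ℕ, evenCoeff (m + 1) / oddCoeff (m + 1)
      = ((∏ j ∈ Finset.range (m + 1), (1 / 4 + (j : ℝ))) ^ 2 *
          ∏ j ∈ Finset.range (m + 1), (3 / 2 + (j : ℝ))) /
        ((∏ j ∈ Finset.range (m + 1), (3 / 4 + (j : ℝ))) ^ 2 *
          ∏ j ∈ Finset.range (m + 1), (1 / 2 + (j : ℝ))) := by
    intro m
    induction m with
    | zero => simp [evenCoeff, oddCoeff]; norm_num
    | succ m ih =>
      rw [evenCoeff, oddCoeff, mul_div_mul_comm, ih]
      simp only [Finset.prod_range_succ _ (m + 1)]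
      have p1 : ∀ t : ℝ, 0 < t → 0 < ∏ j ∈ Finset.range (m + 1), (t + (j : ℝ)) :=
        fun t ht => Finset.prod_pos fun j _ => by positivity
      have q1 := p1 (1 / 4) (by norm_num)
      have q2 := p1 (1 / 2) (by norm_num)
      have q3 := p1 (3 / 4) (by norm_num)
      have q4 := p1 (3 / 2) (by norm_num)
      generalize (∏ j ∈ Finset.range (m + 1), (1 / 4 + (j : ℝ))) = z1 at *
      generalize (∏ j ∈ Finset.range (m + 1), (1 / 2 + (j : ℝ))) = z2 at *
      generalize (∏ j ∈ Finset.range (m + 1), (3 / 4 + (j : ℝ))) = z3 at *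
      generalize (∏ j ∈ Finset.range (m + 1), (3 / 2 + (j : ℝ))) = z4 at *
      push_cast
      field_simp
      ring
  rw [key]
  have p1 : ∀ t : ℝ, 0 < t → 0 < ∏ j ∈ Finset.range (n + 1), (t + (j : ℝ)) :=
    fun t ht => Finset.prod_pos fun j _ => by positivity
  have q1 := p1 (1 / 4) (by norm_num)
  have q2 := p1 (1 / 2) (by norm_num)
  have q3 := p1 (3 / 4) (by norm_num)
  have q4 := p1 (3 / 2) (by norm_num)
  have r1 : (n : ℝ) ^ (3 / 4 : ℝ) = (n : ℝ) ^ (1 / 4 : ℝ) * (n : ℝ) ^ (1 / 2 : ℝ) := by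
    rw [← Real.rpow_add hn0]; norm_num
  have r2 : (n : ℝ) ^ (3 / 2 : ℝ) = (n : ℝ) ^ (1 / 2 : ℝ) * (n : ℝ) ^ (1 / 2 : ℝ)
      * (n : ℝ) ^ (1 / 2 : ℝ) := by
    rw [← Real.rpow_add hn0, ← Real.rpow_add hn0]; norm_num
  have s1 : 0 < (n : ℝ) ^ (1 / 4 : ℝ) := by positivity
  have s2 : 0 < (n : ℝ) ^ (1 / 2 : ℝ) := by positivity
  simp only [Real.GammaSeq]
  rw [r1, r2]
  have hf : (0 : ℝ) < (n.factorial : ℝ) := by positivity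
  generalize (∏ j ∈ Finset.range (n + 1), (1 / 4 + (j : ℝ))) = z1 at *
  generalize (∏ j ∈ Finset.range (n + 1), (1 / 2 + (j : ℝ))) = z2 at *
  generalize (∏ j ∈ Finset.range (n + 1), (3 / 4 + (j : ℝ))) = z3 at *
  generalize (∏ j ∈ Finset.range (n + 1), (3 / 2 + (j : ℝ))) = z4 at *
  generalize (n : ℝ) ^ (1 / 4 : ℝ) = y1 at *
  generalize (n : ℝ) ^ (1 / 2 : ℝ) = y2 at *
  generalize (n.factorial : ℝ) = f at *
  field_simp

/-- The critical slope `2 (Γ(3/4) / Γ(1/4))²`. -/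
noncomputable def critSlope : ℝ := 2 * (Real.Gamma (3 / 4) / Real.Gamma (1 / 4)) ^ 2

lemma tendsto_evenCoeff_div_oddCoeff :
    Filter.Tendsto (fun n => evenCoeff n / oddCoeff n) Filter.atTop (nhds critSlope) := by
  rw [← Filter.tendsto_add_atTop_iff_nat 1]
  have g1 : 0 < Real.Gamma (1 / 4) := Real.Gamma_pos_of_pos (by norm_num)
  have g2 : 0 < Real.Gamma (1 / 2) := Real.Gamma_pos_of_pos (by norm_num)
  have g3 : Real.Gamma (3 / 2) = 1 / 2 * Real.Gamma (1 / 2) := by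
    rw [← Real.Gamma_add_one (by norm_num)]; norm_num
  have h := (((Real.GammaSeq_tendsto_Gamma (3 / 4)).pow 2).mul
    (Real.GammaSeq_tendsto_Gamma (1 / 2))).div
    (((Real.GammaSeq_tendsto_Gamma (1 / 4)).pow 2).mul (Real.GammaSeq_tendsto_Gamma (3 / 2)))
    (by rw [g3]; positivity)
  have e : Real.Gamma (3 / 4) ^ 2 * Real.Gamma (1 / 2) /
      (Real.Gamma (1 / 4) ^ 2 * Real.Gamma (3 / 2)) = critSlope := by
    rw [critSlope, g3]; field_simp
  rw [e] at h
  refine h.congr' ?_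
  filter_upwards [Filter.eventually_ne_atTop 0] with n hn
  exact (evenCoeff_div_oddCoeff_eq n hn).symm

lemma critSlope_mul_oddCoeff_le (n : ℕ) : critSlope * oddCoeff n ≤ evenCoeff n := by
  rw [← le_div_iff₀ (oddCoeff_pos n)]
  exact evenCoeff_div_oddCoeff_antitone.le_of_tendsto tendsto_evenCoeff_div_oddCoeff n

lemma critSlope_pos : 0 < critSlope := by
  have g1 : 0 < Real.Gamma (1 / 4) := Real.Gamma_pos_of_pos (by norm_num)
  have g2 : 0 < Real.Gamma (3 / 4) := Real.Gamma_pos_of_pos (by norm_num)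
  rw [critSlope]; positivity

lemma critSlope_le : critSlope ≤ 1 / 3 := by
  have := critSlope_mul_oddCoeff_le 1
  norm_num [evenCoeff, oddCoeff] at this
  linarith

lemma summable_mul_sq_pow {c : ℕ → ℝ} (h0 : ∀ n, 0 < c n) (h1 : ∀ n, c n ≤ 1) {x : ℝ}
    (hx : |x| < 1) : Summable fun n => c n * (x ^ 2) ^ n := by
  refine summable_coeff_mul_pow (C := 1) (k := 0) (fun n => ?_) ?_
  · rw [abs_of_pos (h0 n)]; simpa using h1 n
  · rw [abs_of_nonneg (sq_nonneg x)]; exact (sq_lt_one_iff_abs_lt_one x).2 hx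

lemma legendreSol_eq (κ : ℝ) {x : ℝ} (hx : |x| < 1) :
    legendreSol κ x = ∑' n, evenCoeff n * (x ^ 2) ^ n
      - κ * x * ∑' n, oddCoeff n * (x ^ 2) ^ n := by
  have sa := summable_mul_sq_pow evenCoeff_pos evenCoeff_le_one hx
  have sb := summable_mul_sq_pow oddCoeff_pos oddCoeff_le_one hx
  have ea : ∀ n, legendreCoeff κ (2 * n) * x ^ (2 * n) = evenCoeff n * (x ^ 2) ^ n := fun n => by
    rw [legendreCoeff_two_mul, pow_mul]
  have eb : ∀ n, legendreCoeff κ (2 * n + 1) * x ^ (2 * n + 1)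
      = -(κ * x) * (oddCoeff n * (x ^ 2) ^ n) := fun n => by
    rw [legendreCoeff_two_mul_add_one, ← pow_mul]; ring
  rw [legendreSol, ← tsum_even_add_odd (f := fun n => legendreCoeff κ n * x ^ n)]
  · simp only [ea, eb]
    rw [tsum_mul_left]; ring
  · simpa only [ea] using sa
  · simpa only [eb] using sb.mul_left _

lemma legendreSol_critSlope_pos {x : ℝ} (h0 : 0 ≤ x) (h1 : x < 1) :
    0 < legendreSol critSlope x := by
  have hx : |x| < 1 := by rwa [abs_of_nonneg h0]
  have sa := summable_mul_sq_pow evenCoeff_pos evenCoeff_le_one hx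
  have sb := summable_mul_sq_pow oddCoeff_pos oddCoeff_le_one hx
  rw [legendreSol_eq _ hx]
  have hB : 0 < ∑' n, oddCoeff n * (x ^ 2) ^ n := by
    refine sb.tsum_pos (fun n => ?_) 0 (by simp [oddCoeff])
    have := oddCoeff_pos n; positivity
  have hAB : critSlope * ∑' n, oddCoeff n * (x ^ 2) ^ n ≤ ∑' n, evenCoeff n * (x ^ 2) ^ n := by
    rw [← tsum_mul_left]
    refine (sb.mul_left _).tsum_le_tsum (fun n => ?_) sa
    rw [← mul_assoc]
    exact mul_le_mul_of_nonneg_right (critSlope_mul_oddCoeff_le n) (by positivity)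
  have := mul_pos (mul_pos critSlope_pos hB) (sub_pos.2 h1)
  nlinarith

lemma exists_legendreSol_nonpos {κ : ℝ} (hκ : critSlope < κ) :
    ∃ x, 0 < x ∧ x < 1 ∧ legendreSol κ x ≤ 0 := by
  by_contra! hcon
  obtain ⟨μ, hμ1, hμ2⟩ := exists_between hκ
  obtain ⟨ν, hν1, hν2⟩ := exists_between hμ2
  have hcrit := critSlope_pos
  obtain ⟨N, hN⟩ := Filter.eventually_atTop.1
    (tendsto_evenCoeff_div_oddCoeff.eventually (gt_mem_nhds hμ1))
  have hb : ∀ n, evenCoeff n - μ * oddCoeff n ≤ if n < N then 1 else 0 := by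
    intro n
    split_ifs with h
    · nlinarith [evenCoeff_le_one n, oddCoeff_pos n]
    · have := hN n (not_lt.1 h)
      rw [div_lt_iff₀ (oddCoeff_pos n)] at this
      linarith
  have bound : ∀ x, ν / κ < x → x < 1 → ∀ M, (ν - μ) * ∑ n ∈ Finset.range M, oddCoeff n * (x ^ 2) ^ n ≤ N := by
    intro x hx0 hx1 M
    have hκ0 : 0 < κ := hcrit.trans hκ
    have hxpos : 0 < x := lt_trans (by have : 0 < ν := by linarith
                                       positivity) hx0
    have hx : |x| < 1 := by rwa [abs_of_pos hxpos]
    have sa := summable_mul_sq_pow evenCoeff_pos evenCoeff_le_one hx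
    have sb := summable_mul_sq_pow oddCoeff_pos oddCoeff_le_one hx
    have hg := hcon x hxpos hx1
    rw [legendreSol_eq _ hx] at hg
    have hM : ∑ n ∈ Finset.range M, oddCoeff n * (x ^ 2) ^ n ≤ ∑' n, oddCoeff n * (x ^ 2) ^ n :=
      sb.sum_le_tsum _ (fun n _ => by have := oddCoeff_pos n; positivity)
    have hB0 : 0 ≤ ∑' n, oddCoeff n * (x ^ 2) ^ n :=
      tsum_nonneg fun n => by have := oddCoeff_pos n; positivity
    have hA : ∑' n, evenCoeff n * (x ^ 2) ^ n - μ * ∑' n, oddCoeff n * (x ^ 2) ^ n ≤ N := by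
      rw [← tsum_mul_left, ← sa.tsum_sub (sb.mul_left _)]
      have hfin : ∑' n : ℕ, (if n < N then (1 : ℝ) else 0) = N := by
        rw [tsum_eq_sum (s := Finset.range N) (fun n hn => by simpa using hn)]
        rw [Finset.sum_congr rfl (g := fun _ => (1 : ℝ))
          (fun n hn => by simpa using Finset.mem_range.1 hn)]
        simp
      rw [← hfin]
      refine (sa.sub (sb.mul_left _)).tsum_le_tsum (fun n => ?_)
        (summable_of_ne_finset_zero (s := Finset.range N) (fun n hn => by simpa using hn))
      have h1 : (x ^ 2) ^ n ≤ 1 := pow_le_one₀ (by positivity) (by nlinarith)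
      have h2 : 0 ≤ (x ^ 2) ^ n := by positivity
      have := hb n
      split_ifs at this ⊢ <;> nlinarith
    rw [div_lt_iff₀ hκ0] at hx0
    nlinarith
  apply not_summable_oddCoeff
  refine summable_of_sum_range_le (c := N / (ν - μ)) (fun n => (oddCoeff_pos n).le) fun M => ?_
  rw [le_div_iff₀ (by linarith), mul_comm]
  have hcont : Filter.Tendsto (fun x : ℝ => (ν - μ) * ∑ n ∈ Finset.range M, oddCoeff n * (x ^ 2) ^ n)
      (nhdsWithin 1 (Set.Iio 1)) (nhds ((ν - μ) * ∑ n ∈ Finset.range M, oddCoeff n * ((1 : ℝ) ^ 2) ^ n)) :=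
    (Continuous.tendsto (by fun_prop) 1).mono_left nhdsWithin_le_nhds
  simp only [one_pow, mul_one] at hcont
  refine le_of_tendsto hcont ?_
  have : ν / κ < 1 := by rw [div_lt_one (by linarith)]; exact hν2
  filter_upwards [Ioo_mem_nhdsLT this] with x hx
  exact bound x hx.1 hx.2 M

/-- `√(sin θ) g(cos θ)` solves `ψ'' + ψ / (4 sin² θ) = 0`. -/
noncomputable def angSol (κ θ : ℝ) : ℝ := √(sin θ) * legendreSol κ (cos θ)

/-- The derivative of `angSol`. -/
noncomputable def angSol' (κ θ : ℝ) : ℝ :=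
  √(sin θ) * (cos θ / (2 * sin θ) * legendreSol κ (cos θ) - sin θ * legendreSol' κ (cos θ))

lemma abs_cos_lt_one_of_sin_pos {θ : ℝ} (h : 0 < sin θ) : |cos θ| < 1 := by
  rw [← sq_lt_one_iff_abs_lt_one]
  nlinarith [sin_sq_add_cos_sq θ]

lemma hasDerivAt_angSol (κ : ℝ) {θ : ℝ} (h : 0 < sin θ) :
    HasDerivAt (angSol κ) (angSol' κ θ) θ := by
  have h1 := (hasDerivAt_sin θ).sqrt h.ne'
  have h2 := (hasDerivAt_legendreSol κ (abs_cos_lt_one_of_sin_pos h)).comp θ (hasDerivAt_cos θ)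
  refine (h1.mul h2).congr_deriv ?_
  simp only [angSol']
  have hs : √(sin θ) ≠ 0 := (Real.sqrt_pos.2 h).ne'
  have hss : √(sin θ) ^ 2 = sin θ := Real.sq_sqrt h.le
  simp only [Function.comp]
  field_simp
  rw [hss]
  ring

lemma hasDerivAt_angSol' (κ : ℝ) {θ : ℝ} (h : 0 < sin θ) :
    HasDerivAt (angSol' κ) (-(angSol κ θ / (4 * sin θ ^ 2))) θ := by
  have hc := abs_cos_lt_one_of_sin_pos h
  have h1 := (hasDerivAt_sin θ).sqrt h.ne'
  have h2 := (hasDerivAt_legendreSol κ hc).comp θ (hasDerivAt_cos θ)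
  have h3 := (hasDerivAt_legendreSol' κ hc).comp θ (hasDerivAt_cos θ)
  have h4 := (hasDerivAt_cos θ).div ((hasDerivAt_sin θ).const_mul 2) (by positivity)
  refine (h1.mul ((h4.mul h2).sub ((hasDerivAt_sin θ).mul h3))).congr_deriv ?_
  have ode := legendreSol_ode κ hc
  simp only [angSol]
  have hs : √(sin θ) ≠ 0 := (Real.sqrt_pos.2 h).ne'
  have hss : √(sin θ) ^ 2 = sin θ := Real.sq_sqrt h.le
  have hcs : cos θ ^ 2 = 1 - sin θ ^ 2 := by linarith [sin_sq_add_cos_sq θ]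
  rw [show 1 - cos θ ^ 2 = sin θ ^ 2 by linarith] at ode
  simp only [Function.comp, Pi.mul_apply, Pi.div_apply, Pi.sub_apply]
  generalize legendreSol κ (cos θ) = g at *
  generalize legendreSol' κ (cos θ) = g' at *
  generalize legendreSol'' κ (cos θ) = g'' at *
  generalize cos θ = c at *
  generalize √(sin θ) = q at *
  generalize sin θ = s at *
  subst hss
  field_simp
  linear_combination (16 * q ^ 4) * ode - 4 * g * hcs

lemma angSol_pi_div_two (κ : ℝ) : angSol κ (π / 2) = 1 := by
  simp [angSol, legendreSol_zero]

lemma angSol'_pi_div_two (κ : ℝ) : angSol' κ (π / 2) = κ := by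
  simp [angSol', legendreSol'_zero]

lemma angSol_critSlope_pos {θ : ℝ} (h0 : 0 < θ) (h1 : θ ≤ π / 2) : 0 < angSol critSlope θ := by
  have hs : 0 < sin θ := sin_pos_of_pos_of_lt_pi h0 (by linarith [pi_pos])
  refine mul_pos (Real.sqrt_pos.2 hs) (legendreSol_critSlope_pos ?_ ?_)
  · exact cos_nonneg_of_mem_Icc ⟨by linarith, h1⟩
  · exact (abs_lt.1 (abs_cos_lt_one_of_sin_pos hs)).2

lemma exists_angSol_eq_zero {κ : ℝ} (hκ : critSlope < κ) :
    ∃ θ, 0 < θ ∧ θ < π / 2 ∧ angSol κ θ = 0 := by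
  obtain ⟨x, hx0, hx1, hx⟩ := exists_legendreSol_nonpos hκ
  have hc : ContinuousOn (legendreSol κ) (Set.Icc 0 x) := fun y hy =>
    (hasDerivAt_legendreSol κ (by rw [abs_of_nonneg hy.1]; linarith [hy.2])).continuousAt.continuousWithinAt
  obtain ⟨y, hy, hy0⟩ := intermediate_value_Icc' hx0.le hc
    (show (0 : ℝ) ∈ Set.Icc _ _ from ⟨hx, by rw [legendreSol_zero]; norm_num⟩)
  have hy1 : 0 < y := by
    rcases hy.1.eq_or_lt with h | h
    · rw [← h, legendreSol_zero] at hy0; norm_num at hy0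
    · exact h
  refine ⟨arccos y, arccos_pos.2 (by linarith [hy.2]), arccos_lt_pi_div_two.2 hy1, ?_⟩
  rw [angSol, cos_arccos (by linarith) (by linarith [hy.2]), hy0, mul_zero]

/-- Picone's inequality on an interval: comparison with a positive solution of `ψ'' + W ψ = 0`. -/
lemma picone_le_integral {a b : ℝ} (hab : a ≤ b) {v v' ψ D W : ℝ → ℝ}
    (hv : ∀ x ∈ Set.Icc a b, HasDerivAt v (v' x) x) (hv' : ContinuousOn v' (Set.Icc a b))
    (hψ : ∀ x ∈ Set.Icc a b, HasDerivAt ψ (D x) x)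
    (hD : ∀ x ∈ Set.Icc a b, HasDerivAt D (-(W x * ψ x)) x)
    (hW : ContinuousOn W (Set.Icc a b)) (hpos : ∀ x ∈ Set.Icc a b, 0 < ψ x) :
    D b / ψ b * v b ^ 2 - D a / ψ a * v a ^ 2 ≤ ∫ x in a..b, (v' x ^ 2 - W x * v x ^ 2) := by
  have hder : ∀ x ∈ Set.Icc a b, HasDerivAt (fun x => D x / ψ x * v x ^ 2)
      ((-(W x * ψ x) * ψ x - D x * D x) / ψ x ^ 2 * v x ^ 2
        + D x / ψ x * (2 * v x * v' x)) x := by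
    intro x hx
    have := ((hD x hx).div (hψ x hx) (hpos x hx).ne').mul ((hv x hx).pow 2)
    refine this.congr_deriv ?_
    simp
  have hcv : ContinuousOn v (Set.Icc a b) := fun x hx => (hv x hx).continuousAt.continuousWithinAt
  refine intervalIntegral.sub_le_integral_of_hasDeriv_right_of_le hab
    (fun x hx => (hder x hx).continuousAt.continuousWithinAt)
    (fun x hx => (hder x (Set.Ioo_subset_Icc_self hx)).hasDerivWithinAt)
    (ContinuousOn.integrableOn_Icc ((hv'.pow 2).sub (hW.mul (hcv.pow 2)))) ?_
  intro x hx
  have hp := hpos x (Set.Ioo_subset_Icc_self hx)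
  have e : v' x ^ 2 - W x * v x ^ 2 - ((-(W x * ψ x) * ψ x - D x * D x) / ψ x ^ 2 * v x ^ 2
        + D x / ψ x * (2 * v x * v' x)) = (v' x - D x / ψ x * v x) ^ 2 := by
    field_simp; ring
  have := sq_nonneg (v' x - D x / ψ x * v x)
  linarith

/-- The energy of a solution of `ψ'' + W ψ = 0`. -/
lemma integral_energy_eq {a b : ℝ} (hab : a ≤ b) {ψ D W : ℝ → ℝ}
    (hψ : ∀ x ∈ Set.Icc a b, HasDerivAt ψ (D x) x)
    (hD : ∀ x ∈ Set.Icc a b, HasDerivAt D (-(W x * ψ x)) x)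
    (hW : ContinuousOn W (Set.Icc a b)) :
    ∫ x in a..b, (D x ^ 2 - W x * ψ x ^ 2) = D b * ψ b - D a * ψ a := by
  have c1 : ContinuousOn ψ (Set.Icc a b) := fun x hx => (hψ x hx).continuousAt.continuousWithinAt
  have c2 : ContinuousOn D (Set.Icc a b) := fun x hx => (hD x hx).continuousAt.continuousWithinAt
  refine intervalIntegral.integral_eq_sub_of_hasDerivAt (f := fun x => D x * ψ x)
    (fun x hx => ?_) ?_
  · rw [Set.uIcc_of_le hab] at hx
    exact ((hD x hx).mul (hψ x hx)).congr_deriv (by ring)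
  · refine ContinuousOn.intervalIntegrable ?_
    rw [Set.uIcc_of_le hab]
    exact (c2.pow 2).sub (hW.mul (c1.pow 2))

/-- The distance of `(cos θ, sin θ)` to the positive horizontal half-line, for `0 < θ < π`. -/
noncomputable def raySin (θ : ℝ) : ℝ := sin (min θ (π / 2))

/-- The distance of `(cos θ, sin θ)` to the boundary of the sector of angle `β`. -/
noncomputable def angDist (β θ : ℝ) : ℝ := min (raySin θ) (raySin (β - θ))

lemma continuous_raySin : Continuous raySin := by
  unfold raySin; fun_prop

lemma continuous_angDist (β : ℝ) : Continuous (angDist β) :=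
  continuous_raySin.min (continuous_raySin.comp (by fun_prop))

lemma raySin_of_le {θ : ℝ} (h : θ ≤ π / 2) : raySin θ = sin θ := by rw [raySin, min_eq_left h]

lemma raySin_of_ge {θ : ℝ} (h : π / 2 ≤ θ) : raySin θ = 1 := by
  rw [raySin, min_eq_right h, sin_pi_div_two]

lemma raySin_le_one (θ : ℝ) : raySin θ ≤ 1 := sin_le_one _

lemma raySin_pos {θ : ℝ} (h : 0 < θ) : 0 < raySin θ :=
  sin_pos_of_pos_of_lt_pi (lt_min h (by positivity))
    ((min_le_right _ _).trans_lt (by linarith [pi_pos]))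

lemma angDist_pos {β θ : ℝ} (h0 : 0 < θ) (h1 : θ < β) : 0 < angDist β θ :=
  lt_min (raySin_pos h0) (raySin_pos (by linarith))

lemma angDist_symm (β θ : ℝ) : angDist β (β - θ) = angDist β θ := by
  rw [angDist, angDist, min_comm, sub_sub_cancel]

lemma angDist_of_le {β θ : ℝ} (hβ : π ≤ β) (h : θ ≤ π / 2) : angDist β θ = sin θ := by
  rw [angDist, raySin_of_le h, raySin_of_ge (by linarith), min_eq_left (sin_le_one _)]

lemma angDist_of_mid {β θ : ℝ} (h0 : π / 2 ≤ θ) (h1 : θ ≤ β - π / 2) : angDist β θ = 1 := by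
  rw [angDist, raySin_of_ge h0, raySin_of_ge (by linarith), min_self]

lemma angDist_of_ge {β θ : ℝ} (hβ : π ≤ β) (h : β - π / 2 ≤ θ) : angDist β θ = sin (β - θ) := by
  rw [← angDist_symm, angDist_of_le hβ (by linarith)]

lemma continuousOn_inv_sin_sq {a b : ℝ} (ha : 0 < a) (hb : b < π) :
    ContinuousOn (fun θ => 1 / (4 * sin θ ^ 2)) (Set.Icc a b) := by
  refine ContinuousOn.div (by fun_prop) (by fun_prop) fun x hx => ?_
  have : 0 < sin x := sin_pos_of_pos_of_lt_pi (by linarith [hx.1]) (by linarith [hx.2])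
  positivity

lemma hasDerivAt_midSol (β x : ℝ) : HasDerivAt (fun θ => cos ((θ - β / 2) / 2))
    (-(1 / 2) * sin ((x - β / 2) / 2)) x := by
  have h : HasDerivAt (fun θ : ℝ => (θ - β / 2) / 2) (1 / 2) x :=
    ((hasDerivAt_id x).sub_const _).div_const 2
  exact h.cos.congr_deriv (by ring)

lemma hasDerivAt_midSol' (β x : ℝ) : HasDerivAt (fun θ => -(1 / 2) * sin ((θ - β / 2) / 2))
    (-(1 / 4 * cos ((x - β / 2) / 2))) x := by
  have h : HasDerivAt (fun θ : ℝ => (θ - β / 2) / 2) (1 / 2) x :=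
    ((hasDerivAt_id x).sub_const _).div_const 2
  exact (h.sin.const_mul (-(1 / 2))).congr_deriv (by ring)

lemma crit_side_le {a : ℝ} (ha : 0 < a) (ha2 : a < π / 2) {v v' : ℝ → ℝ}
    (hv : ∀ x ∈ Set.Icc a (π / 2), HasDerivAt v (v' x) x)
    (hv' : ContinuousOn v' (Set.Icc a (π / 2))) (h0 : v a = 0) :
    critSlope * v (π / 2) ^ 2 ≤ ∫ x in a..(π / 2), (v' x ^ 2 - 1 / (4 * sin x ^ 2) * v x ^ 2) := by
  have hs : ∀ x ∈ Set.Icc a (π / 2), 0 < sin x := fun x hx =>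
    sin_pos_of_pos_of_lt_pi (by linarith [hx.1]) (by linarith [hx.2, pi_pos])
  have := picone_le_integral ha2.le (ψ := angSol critSlope) (D := angSol' critSlope)
    (W := fun θ => 1 / (4 * sin θ ^ 2)) hv hv' (fun x hx => hasDerivAt_angSol _ (hs x hx))
    (fun x hx => (hasDerivAt_angSol' _ (hs x hx)).congr_deriv (by ring))
    (continuousOn_inv_sin_sq ha (by linarith [pi_pos]))
    (fun x hx => angSol_critSlope_pos (by linarith [hx.1]) hx.2)
  simpa [h0, angSol_pi_div_two, angSol'_pi_div_two] using this

/-- The angular Hardy inequality at the critical angle. -/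
lemma angular_hardy {β : ℝ} (hβ : π ≤ β) (hβ2 : β ≤ 2 * π)
    (htan : tan ((β - π) / 4) = 2 * critSlope) {a : ℝ} (ha : 0 < a) (ha2 : a < π / 2) {v v' : ℝ → ℝ}
    (hv : ∀ x ∈ Set.Icc a (β - a), HasDerivAt v (v' x) x)
    (hv' : ContinuousOn v' (Set.Icc a (β - a))) (h0 : v a = 0) (h1 : v (β - a) = 0) :
    0 ≤ ∫ x in a..(β - a), (v' x ^ 2 - 1 / 4 * (v x ^ 2 / angDist β x ^ 2)) := by
  have hpi := pi_pos
  have i1 := crit_side_le ha ha2 (v := v) (v' := v')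
    (fun x hx => hv x ⟨hx.1, by linarith [hx.2]⟩)
    (hv'.mono (Set.Icc_subset_Icc le_rfl (by linarith))) h0
  have hmap : ∀ x ∈ Set.Icc a (π / 2), β - x ∈ Set.Icc a (β - a) :=
    fun x hx => ⟨by linarith [hx.2], by linarith [hx.1]⟩
  have i3 := crit_side_le ha ha2 (v := fun x => v (β - x)) (v' := fun x => -v' (β - x))
    (fun x hx => by
      have := (hv _ (hmap x hx)).comp x ((hasDerivAt_id x).const_sub β)
      exact this.congr_deriv (by simp))
    (hv'.comp (by fun_prop) hmap).neg h1
  have i2 := picone_le_integral (a := π / 2) (b := β - π / 2) (by linarith)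
    (v := v) (v' := v') (ψ := fun θ => cos ((θ - β / 2) / 2))
    (D := fun θ => -(1 / 2) * sin ((θ - β / 2) / 2)) (W := fun _ => 1 / 4)
    (fun x hx => hv x ⟨by linarith [hx.1], by linarith [hx.2]⟩)
    (hv'.mono (Set.Icc_subset_Icc (by linarith) (by linarith)))
    (fun x _ => hasDerivAt_midSol β x) (fun x _ => hasDerivAt_midSol' β x) (by fun_prop)
    (fun x hx => cos_pos_of_mem_Ioo ⟨by linarith [hx.1], by linarith [hx.2]⟩)
  have hc : 0 < cos ((β - π) / 4) := cos_pos_of_mem_Ioo ⟨by linarith, by linarith⟩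
  have hsin : sin ((β - π) / 4) = 2 * critSlope * cos ((β - π) / 4) := by
    rw [← htan, tan_mul_cos hc.ne']
  simp only [show (β - π / 2 - β / 2) / 2 = (β - π) / 4 by ring,
    show (π / 2 - β / 2) / 2 = -((β - π) / 4) by ring, sin_neg, cos_neg, hsin] at i2
  rw [show -(1 / 2) * (2 * critSlope * cos ((β - π) / 4)) / cos ((β - π) / 4) = -critSlope by
      field_simp,
    show -(1 / 2) * -(2 * critSlope * cos ((β - π) / 4)) / cos ((β - π) / 4) = critSlope by
      field_simp] at i2
  have hcv : ContinuousOn v (Set.Icc a (β - a)) :=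
    fun x hx => (hv x hx).continuousAt.continuousWithinAt
  have hcF : ContinuousOn (fun x => v' x ^ 2 - 1 / 4 * (v x ^ 2 / angDist β x ^ 2))
      (Set.Icc a (β - a)) := by
    refine (hv'.pow 2).sub (continuousOn_const.mul
      ((hcv.pow 2).div ((continuous_angDist β).continuousOn.pow 2) fun x hx => ?_))
    have := angDist_pos (β := β) (θ := x) (by linarith [hx.1]) (by linarith [hx.2])
    positivity
  have hzero : ∀ c d, a ≤ c → c ≤ d → d ≤ β - a → IntervalIntegrable
      (fun x => v' x ^ 2 - 1 / 4 * (v x ^ 2 / angDist β x ^ 2)) volume c d := by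
    intro c d h1 h2 h3
    refine ContinuousOn.intervalIntegrable ?_
    rw [Set.uIcc_of_le h2]
    exact hcF.mono (Set.Icc_subset_Icc h1 h3)
  rw [← intervalIntegral.integral_add_adjacent_intervals (b := β - π / 2)
    (hzero _ _ le_rfl (by linarith) (by linarith)) (hzero _ _ (by linarith) (by linarith) le_rfl),
    ← intervalIntegral.integral_add_adjacent_intervals (b := π / 2)
    (hzero _ _ le_rfl (by linarith) (by linarith)) (hzero _ _ (by linarith) (by linarith)
      (by linarith))]
  have e1 : ∫ x in a..(π / 2), (v' x ^ 2 - 1 / 4 * (v x ^ 2 / angDist β x ^ 2))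
      = ∫ x in a..(π / 2), (v' x ^ 2 - 1 / (4 * sin x ^ 2) * v x ^ 2) := by
    refine intervalIntegral.integral_congr fun x hx => ?_
    rw [Set.uIcc_of_le ha2.le] at hx
    rw [angDist_of_le hβ hx.2]; ring
  have e2 : ∫ x in (π / 2)..(β - π / 2), (v' x ^ 2 - 1 / 4 * (v x ^ 2 / angDist β x ^ 2))
      = ∫ x in (π / 2)..(β - π / 2), (v' x ^ 2 - 1 / 4 * v x ^ 2) := by
    refine intervalIntegral.integral_congr fun x hx => ?_
    rw [Set.uIcc_of_le (by linarith)] at hx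
    rw [angDist_of_mid hx.1 hx.2]; ring
  have e3 : ∫ x in (β - π / 2)..(β - a), (v' x ^ 2 - 1 / 4 * (v x ^ 2 / angDist β x ^ 2))
      = ∫ x in a..(π / 2), ((-v' (β - x)) ^ 2 - 1 / (4 * sin x ^ 2) * v (β - x) ^ 2) := by
    rw [← intervalIntegral.integral_comp_sub_left
      (fun x => v' x ^ 2 - 1 / 4 * (v x ^ 2 / angDist β x ^ 2)) β]
    refine intervalIntegral.integral_congr fun x hx => ?_
    rw [Set.uIcc_of_le ha2.le] at hx
    rw [angDist_symm, angDist_of_le hβ hx.2]; ring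
  rw [e1, e2, e3]
  linarith

/-- The point with polar coordinates `(r, θ)`. -/
noncomputable def polarPoint (r θ : ℝ) : EuclideanSpace ℝ (Fin 2) := !₂[r * cos θ, r * sin θ]

@[simp] lemma polarPoint_zero (r θ : ℝ) : polarPoint r θ 0 = r * cos θ := by simp [polarPoint]

@[simp] lemma polarPoint_one (r θ : ℝ) : polarPoint r θ 1 = r * sin θ := by simp [polarPoint]

lemma continuous_polarPoint : Continuous fun p : ℝ × ℝ => polarPoint p.1 p.2 := by
  unfold polarPoint
  refine (PiLp.continuous_toLp 2 _).comp (continuous_pi fun i => ?_)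
  fin_cases i <;> simp <;> fun_prop

lemma eq_of_polarPoint_eq {t r φ θ : ℝ} (ht : 0 ≤ t) (hr : 0 < r) (hφ : φ ∈ Set.Icc 0 (2 * π))
    (hθ : θ ∈ Set.Ioo 0 (2 * π)) (h0 : t * cos φ = r * cos θ) (h1 : t * sin φ = r * sin θ) :
    φ = θ := by
  have htr : t = r := by
    have h : t ^ 2 = r ^ 2 := by
      calc t ^ 2 = (t * cos φ) ^ 2 + (t * sin φ) ^ 2 := by
            linear_combination (-t ^ 2) * sin_sq_add_cos_sq φ
        _ = r ^ 2 := by rw [h0, h1]; linear_combination (r ^ 2) * sin_sq_add_cos_sq θ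
    exact (sq_eq_sq₀ ht hr.le).1 h
  subst htr
  have e0 := mul_left_cancel₀ hr.ne' h0
  have e1 := mul_left_cancel₀ hr.ne' h1
  have hc : cos (φ - θ) = 1 := by
    rw [cos_sub, e0, e1]; linarith [sin_sq_add_cos_sq θ]
  have := (cos_eq_one_iff_of_lt_of_lt (by linarith [hφ.1, hθ.2]) (by linarith [hφ.2, hθ.1])).1 hc
  linarith

lemma polarPoint_notMem_sector {β t φ : ℝ} (hβ : β ≤ 2 * π) (ht : 0 ≤ t)
    (hφ : φ ∈ Set.Icc 0 (2 * π)) (h : ¬ (0 < φ ∧ φ < β)) : polarPoint t φ ∉ sector β := by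
  rintro ⟨r, θ, hr, h0, h1, e0, e1⟩
  simp only [polarPoint_zero, polarPoint_one] at e0 e1
  have := eq_of_polarPoint_eq ht hr hφ ⟨h0, by linarith⟩ e0 e1
  exact h ⟨this ▸ h0, this ▸ h1⟩

lemma polarPoint_mem_sector {β r θ : ℝ} (hr : 0 < r) (h0 : 0 < θ) (h1 : θ < β) :
    polarPoint r θ ∈ sector β := ⟨r, θ, hr, h0, h1, by simp, by simp⟩

/-- The complex number `-(x₀ + i x₁)`, whose argument plus `π` is the polar angle in `(0, 2π]`. -/
noncomputable def negComplex (x : EuclideanSpace ℝ (Fin 2)) : ℂ := ⟨-x 0, -x 1⟩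

lemma negComplex_polarPoint (r θ : ℝ) :
    negComplex (polarPoint r θ) = r * (Complex.cos ((θ - π : ℝ) : ℂ) + Complex.sin ((θ - π : ℝ) : ℂ) * Complex.I) := by
  apply Complex.ext
  · simp [negComplex, ← Complex.ofReal_cos, ← Complex.ofReal_sin, -Complex.ofReal_sub, cos_sub_pi]
  · simp [negComplex, ← Complex.ofReal_cos, ← Complex.ofReal_sin, -Complex.ofReal_sub, sin_sub_pi]

lemma norm_negComplex_polarPoint {r : ℝ} (hr : 0 ≤ r) (θ : ℝ) : ‖negComplex (polarPoint r θ)‖ = r := by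
  rw [negComplex_polarPoint, norm_mul, Complex.norm_cos_add_sin_mul_I, mul_one]
  simpa using hr

lemma arg_negComplex_polarPoint {r θ : ℝ} (hr : 0 < r) (h : θ ∈ Set.Ioc 0 (2 * π)) :
    (negComplex (polarPoint r θ)).arg = θ - π := by
  rw [negComplex_polarPoint, Complex.arg_mul_cos_add_sin_mul_I hr]
  constructor <;> linarith [h.1, h.2]

lemma polarPoint_negComplex (x : EuclideanSpace ℝ (Fin 2)) :
    polarPoint ‖negComplex x‖ ((negComplex x).arg + π) = x := by
  ext i
  fin_cases i
  · simp [cos_add_pi, Complex.norm_mul_cos_arg, negComplex]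
  · simp [sin_add_pi, Complex.norm_mul_sin_arg, negComplex]

lemma continuous_negComplex : Continuous negComplex := by
  have : negComplex = fun x => ((-x 0 : ℝ) : ℂ) + ((-x 1 : ℝ) : ℂ) * Complex.I := by
    funext x
    apply Complex.ext <;> simp [negComplex]
  rw [this]; fun_prop

lemma mem_sector_iff {β : ℝ} (hβ : β ≤ 2 * π) (x : EuclideanSpace ℝ (Fin 2)) :
    x ∈ sector β ↔ negComplex x ≠ 0 ∧ (negComplex x).arg + π < β := by
  have h1 := Complex.neg_pi_lt_arg (negComplex x)
  have h2 := Complex.arg_le_pi (negComplex x)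
  constructor
  · intro h
    constructor
    · intro h0
      have := polarPoint_negComplex x
      rw [h0] at this
      rw [← this] at h
      have h3 : polarPoint ‖(0 : ℂ)‖ (Complex.arg 0 + π) = polarPoint 0 0 := by
        ext i; fin_cases i <;> simp
      rw [h3] at h
      exact polarPoint_notMem_sector hβ le_rfl ⟨le_rfl, by positivity⟩ (by simp) h
    · by_contra hc
      rw [← polarPoint_negComplex x] at h
      exact polarPoint_notMem_sector hβ (norm_nonneg _) ⟨by linarith, by linarith⟩
        (fun h => hc h.2) h
  · rintro ⟨h0, h⟩
    rw [← polarPoint_negComplex x]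
    exact polarPoint_mem_sector (norm_pos_iff.2 h0) (by linarith) h

lemma measurableSet_sector {β : ℝ} (hβ : β ≤ 2 * π) : MeasurableSet (sector β) := by
  have : sector β = negComplex ⁻¹' ({0}ᶜ ∩ {z | z.arg + π < β}) := by
    ext x; rw [mem_sector_iff hβ]; rfl
  rw [this]
  exact continuous_negComplex.measurable ((measurableSet_singleton 0).compl.inter
    (measurableSet_lt (Complex.measurable_arg.add_const π) measurable_const))

lemma dist_polarPoint_sq (r s θ φ : ℝ) :
    dist (polarPoint r θ) (polarPoint s φ) ^ 2 = r ^ 2 + s ^ 2 - 2 * r * s * cos (φ - θ) := by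
  rw [EuclideanSpace.dist_eq, sq_sqrt (by positivity)]
  simp only [Fin.sum_univ_two, polarPoint_zero, polarPoint_one, Real.dist_eq, sq_abs]
  rw [cos_sub]
  linear_combination r ^ 2 * sin_sq_add_cos_sq θ + s ^ 2 * sin_sq_add_cos_sq φ

lemma angDist_le_one (β θ : ℝ) : angDist β θ ≤ 1 := (min_le_left _ _).trans (raySin_le_one _)

lemma compl_sector_nonempty {β : ℝ} (hβ : β ≤ 2 * π) : (sector β)ᶜ.Nonempty :=
  ⟨polarPoint 0 0, polarPoint_notMem_sector hβ le_rfl ⟨le_rfl, by positivity⟩ (by simp)⟩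

lemma infDist_sector {β r θ : ℝ} (hβ : π ≤ β) (hβ2 : β ≤ 2 * π) (hr : 0 < r) (h0 : 0 < θ)
    (h1 : θ < β) : Metric.infDist (polarPoint r θ) (sector β)ᶜ = r * angDist β θ := by
  have hpi := pi_pos
  have hm := angDist_pos h0 h1
  have hm1 := angDist_le_one β θ
  apply le_antisymm
  · suffices h : ∃ s φ, polarPoint s φ ∉ sector β ∧
        r ^ 2 + s ^ 2 - 2 * r * s * cos (φ - θ) ≤ (r * angDist β θ) ^ 2 by
      obtain ⟨s, φ, hs, h⟩ := h
      refine (Metric.infDist_le_dist_of_mem (Set.mem_compl hs)).trans ?_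
      refine (sq_le_sq₀ dist_nonneg (by positivity)).1 ?_
      rwa [dist_polarPoint_sq]
    rcases le_total θ (π / 2) with h | h
    · refine ⟨r * cos θ, 0, polarPoint_notMem_sector hβ2 ?_ ⟨le_rfl, by positivity⟩ (by simp), ?_⟩
      · exact mul_nonneg hr.le (cos_nonneg_of_mem_Icc ⟨by linarith, h⟩)
      · rw [angDist_of_le hβ h, zero_sub, cos_neg]
        apply le_of_eq
        linear_combination (-r ^ 2) * sin_sq_add_cos_sq θ
    rcases le_total θ (β - π / 2) with h' | h'
    · refine ⟨0, 0, polarPoint_notMem_sector hβ2 le_rfl ⟨le_rfl, by positivity⟩ (by simp), ?_⟩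
      rw [angDist_of_mid h h']; simp
    · refine ⟨r * cos (β - θ), β, polarPoint_notMem_sector hβ2 ?_ ⟨by linarith, hβ2⟩ (by simp), ?_⟩
      · exact mul_nonneg hr.le (cos_nonneg_of_mem_Icc ⟨by linarith, by linarith⟩)
      · rw [angDist_of_ge hβ h']
        apply le_of_eq
        linear_combination (-r ^ 2) * sin_sq_add_cos_sq (β - θ)
  · refine (Metric.le_infDist (compl_sector_nonempty hβ2)).2 fun y hy => ?_
    rw [Set.mem_compl_iff, mem_sector_iff hβ2, not_and_or, not_not, not_lt] at hy
    rw [← polarPoint_negComplex y]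
    refine (sq_le_sq₀ (by positivity) dist_nonneg).1 ?_
    rw [dist_polarPoint_sq]
    have hr2 : (r * angDist β θ) ^ 2 ≤ r ^ 2 := by
      refine pow_le_pow_left₀ (by positivity) ?_ 2
      nlinarith
    rcases hy with hy | hy
    · rw [hy]; simpa using hr2
    have hs := norm_nonneg (negComplex y)
    have hφ2 : (negComplex y).arg + π ≤ 2 * π := by linarith [Complex.arg_le_pi (negComplex y)]
    generalize (negComplex y).arg + π = φ at *
    generalize ‖negComplex y‖ = s at *
    rcases le_or_gt (cos (φ - θ)) 0 with hc | hc
    · have : 0 ≤ r * s * (-cos (φ - θ)) := by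
        have : 0 ≤ -cos (φ - θ) := by linarith
        positivity
      nlinarith [sq_nonneg s]
    have key : angDist β θ ^ 2 ≤ sin (φ - θ) ^ 2 := by
      rcases lt_or_ge (φ - θ) (π / 2) with h | h
      · rw [angDist_of_ge hβ (by linarith)]
        refine pow_le_pow_left₀ (sin_nonneg_of_nonneg_of_le_pi (by linarith) (by linarith)) ?_ 2
        exact sin_le_sin_of_le_of_le_pi_div_two (by linarith) h.le (by linarith)
      · have h3 : 3 * π / 2 < φ - θ := by
          by_contra hcon
          have := cos_nonpos_of_pi_div_two_le_of_le h (by linarith)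
          linarith
        rw [angDist_of_le hβ (by linarith),
          show sin (φ - θ) ^ 2 = sin (2 * π - (φ - θ)) ^ 2 by rw [sin_two_pi_sub, neg_sq]]
        refine pow_le_pow_left₀ (sin_nonneg_of_nonneg_of_le_pi (by linarith) (by linarith)) ?_ 2
        exact sin_le_sin_of_le_of_le_pi_div_two (by linarith) (by linarith) (by linarith)
    rw [mul_pow]
    have := mul_le_mul_of_nonneg_left key (sq_nonneg r)
    have e := sin_sq_add_cos_sq (φ - θ)
    nlinarith [sq_nonneg (s - r * cos (φ - θ))]

/-- Integration in polar coordinates with angle in `(0, 2π)`. -/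
lemma integral_eq_polar (G : EuclideanSpace ℝ (Fin 2) → ℝ) :
    ∫ x, G x = ∫ p in Set.Ioi (0 : ℝ) ×ˢ Set.Ioo 0 (2 * π), p.1 * G (polarPoint p.1 p.2) := by
  have e1 : ∫ x, G x = ∫ p : ℝ × ℝ, G !₂[p.1, p.2] := by
    rw [← ((EuclideanSpace.volume_preserving_symm_measurableEquiv_toLp (Fin 2)).symm).integral_comp
      (MeasurableEquiv.measurableEmbedding _) G,
      ← (volume_preserving_finTwoArrow ℝ).symm.integral_comp
        (MeasurableEquiv.measurableEmbedding _)]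
    rfl
  have e2 : ∫ p : ℝ × ℝ, G !₂[p.1, p.2] = ∫ p : ℝ × ℝ, G !₂[-p.1, -p.2] :=
    (integral_neg_eq_self (fun p : ℝ × ℝ => G !₂[p.1, p.2]) volume).symm
  rw [e1, e2, ← integral_comp_polarCoord_symm]
  have ht : polarCoord.target = Set.Ioi (0 : ℝ) ×ˢ Set.Ioo (-π) π := rfl
  rw [ht, ← integral_indicator (measurableSet_Ioi.prod measurableSet_Ioo),
    ← integral_indicator (measurableSet_Ioi.prod measurableSet_Ioo),
    ← integral_sub_right_eq_self _ ((0, π) : ℝ × ℝ)]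
  congr 1
  funext p
  simp only [Set.indicator, Set.mem_prod, Set.mem_Ioi, Set.mem_Ioo, Prod.fst_sub, Prod.snd_sub,
    sub_zero, polarCoord_symm_apply, smul_eq_mul, cos_sub_pi, sin_sub_pi, mul_neg, neg_neg]
  have : (-π < p.2 - π ∧ p.2 - π < π) ↔ (0 < p.2 ∧ p.2 < 2 * π) := by
    constructor <;> rintro ⟨h1, h2⟩ <;> constructor <;> linarith
  simp only [this]
  rfl

lemma integral_sector_eq_polar {β : ℝ} (hβ2 : β ≤ 2 * π)
    (F : EuclideanSpace ℝ (Fin 2) → ℝ) :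
    ∫ x in sector β, F x
      = ∫ p in Set.Ioi (0 : ℝ) ×ˢ Set.Ioo 0 β, p.1 * F (polarPoint p.1 p.2) := by
  rw [← integral_indicator (measurableSet_sector hβ2), integral_eq_polar,
    ← integral_indicator (measurableSet_Ioi.prod measurableSet_Ioo),
    ← integral_indicator (measurableSet_Ioi.prod measurableSet_Ioo)]
  congr 1
  funext p
  simp only [Set.indicator, Set.mem_prod, Set.mem_Ioi, Set.mem_Ioo]
  by_cases h1 : 0 < p.1 ∧ 0 < p.2 ∧ p.2 < 2 * π
  · rw [if_pos h1]
    by_cases h2 : p.2 < β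
    · rw [if_pos (polarPoint_mem_sector h1.1 h1.2.1 h2), if_pos ⟨h1.1, h1.2.1, h2⟩]
    · rw [if_neg (polarPoint_notMem_sector hβ2 h1.1.le ⟨h1.2.1.le, h1.2.2.le⟩ fun h => h2 h.2),
        if_neg fun h => h2 h.2.2, mul_zero]
  · rw [if_neg h1, if_neg fun h => h1 ⟨h.1, h.2.1, by linarith [h.2.2]⟩]

lemma norm_polarPoint (r θ : ℝ) : ‖polarPoint r θ‖ = |r| := by
  rw [EuclideanSpace.norm_eq, Fin.sum_univ_two, polarPoint_zero, polarPoint_one, ← sqrt_sq_eq_abs]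
  congr 1
  simp only [Real.norm_eq_abs, sq_abs]
  linear_combination r ^ 2 * sin_sq_add_cos_sq θ

lemma integrableOn_polar {F : EuclideanSpace ℝ (Fin 2) → ℝ} (hF : Continuous F)
    (hc : HasCompactSupport F) (β : ℝ) :
    IntegrableOn (fun p : ℝ × ℝ => p.1 * F (polarPoint p.1 p.2))
      (Set.Ioi (0 : ℝ) ×ˢ Set.Ioo 0 β) := by
  obtain ⟨R, hR⟩ := hc.isCompact.isBounded.exists_norm_le
  have hcont : Continuous fun p : ℝ × ℝ => p.1 * F (polarPoint p.1 p.2) :=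
    continuous_fst.mul (hF.comp continuous_polarPoint)
  have h1 : IntegrableOn (fun p : ℝ × ℝ => p.1 * F (polarPoint p.1 p.2))
      (Set.Icc (0 : ℝ) R ×ˢ Set.Icc 0 β) :=
    hcont.continuousOn.integrableOn_compact (isCompact_Icc.prod isCompact_Icc)
  refine h1.of_forall_sdiff_eq_zero (measurableSet_Ioi.prod measurableSet_Ioo) ?_
  rintro ⟨r, θ⟩ ⟨⟨hr, hθ⟩, hn⟩
  simp only [Set.mem_Ioi] at hr
  by_cases h : F (polarPoint r θ) = 0
  · simp [h]
  · have := hR _ (subset_tsupport F h)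
    rw [norm_polarPoint, abs_of_pos hr] at this
    exact absurd ⟨⟨hr.le, this⟩, Set.Ioo_subset_Icc_self hθ⟩ hn

lemma infDist_pos_of_mem_sector {β : ℝ} (hβ : π ≤ β) (hβ2 : β ≤ 2 * π)
    {x : EuclideanSpace ℝ (Fin 2)} (hx : x ∈ sector β) : 0 < Metric.infDist x (sector β)ᶜ := by
  obtain ⟨r, θ, hr, h0, h1, e0, e1⟩ := hx
  have : x = polarPoint r θ := by
    ext i; fin_cases i
    · simpa using e0
    · simpa using e1
  rw [this, infDist_sector hβ hβ2 hr h0 h1]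
  exact mul_pos hr (angDist_pos h0 h1)

lemma continuous_sq_div_infDist_sq {β : ℝ} (hβ : π ≤ β) (hβ2 : β ≤ 2 * π)
    {u : EuclideanSpace ℝ (Fin 2) → ℝ} (hu : Continuous u) (hs : tsupport u ⊆ sector β) :
    Continuous fun x => u x ^ 2 / Metric.infDist x (sector β)ᶜ ^ 2 := by
  rw [continuous_iff_continuousAt]
  intro x
  by_cases hx : x ∈ tsupport u
  · have := infDist_pos_of_mem_sector hβ hβ2 (hs hx)
    exact (hu.continuousAt.pow 2).div ((Metric.continuous_infDist_pt _).continuousAt.pow 2)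
      (by positivity)
  · have h : (fun x => u x ^ 2 / Metric.infDist x (sector β)ᶜ ^ 2) =ᶠ[nhds x] fun _ => 0 := by
      filter_upwards [(isClosed_tsupport u).isOpen_compl.mem_nhds hx] with y hy
      rw [image_eq_zero_of_notMem_tsupport hy]; simp
    exact (continuousAt_const).congr h.symm

lemma hasCompactSupport_sq_div {u : EuclideanSpace ℝ (Fin 2) → ℝ} (hc : HasCompactSupport u)
    (g : EuclideanSpace ℝ (Fin 2) → ℝ) : HasCompactSupport fun x => u x ^ 2 / g x :=
  hc.mono fun x hx h => hx (by simp [h])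

lemma continuous_norm_gradient_sq {u : EuclideanSpace ℝ (Fin 2) → ℝ}
    (hu : ContDiff ℝ (⊤ : ℕ∞) u) : Continuous fun x => ‖gradient u x‖ ^ 2 := by
  have h : Continuous (fderiv ℝ u) := hu.continuous_fderiv (by simp)
  simp only [gradient, LinearIsometryEquiv.norm_map]
  fun_prop

lemma hasCompactSupport_norm_gradient_sq {u : EuclideanSpace ℝ (Fin 2) → ℝ}
    (hc : HasCompactSupport u) : HasCompactSupport fun x => ‖gradient u x‖ ^ 2 := by
  refine (hc.fderiv (𝕜 := ℝ)).mono fun x hx h => hx ?_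
  simp only [gradient, LinearIsometryEquiv.norm_map]
  rw [h]; simp

lemma hasDerivAt_comp_curve {u : EuclideanSpace ℝ (Fin 2) → ℝ} {γ : ℝ → EuclideanSpace ℝ (Fin 2)}
    {t a b : ℝ} (hu : DifferentiableAt ℝ u (γ t)) (h0 : HasDerivAt (fun s => γ s 0) a t)
    (h1 : HasDerivAt (fun s => γ s 1) b t) :
    HasDerivAt (fun s => u (γ s)) (gradient u (γ t) 0 * a + gradient u (γ t) 1 * b) t := by
  have hγ : HasDerivAt γ (!₂[a, b]) t := by
    have h : HasDerivAt (fun s => (fun i => γ s i : Fin 2 → ℝ)) ![a, b] t := by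
      rw [hasDerivAt_pi]
      intro i; fin_cases i
      · exact h0
      · exact h1
    exact ((EuclideanSpace.equiv (Fin 2) ℝ).symm.hasFDerivAt).comp_hasDerivAt t h
  have := hu.hasGradientAt.hasFDerivAt.comp_hasDerivAt t hγ
  refine this.congr_deriv ?_
  rw [InnerProductSpace.toDual_apply_apply, PiLp.inner_apply, Fin.sum_univ_two]
  simp; ring

lemma hasDerivAt_angular {u : EuclideanSpace ℝ (Fin 2) → ℝ} (hu : Differentiable ℝ u) (r θ : ℝ) :
    HasDerivAt (fun t => u (polarPoint r t))
      (r * (gradient u (polarPoint r θ) 1 * cos θ - gradient u (polarPoint r θ) 0 * sin θ)) θ := by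
  refine (hasDerivAt_comp_curve (γ := fun t => polarPoint r t) hu.differentiableAt
    (a := r * (-sin θ)) (b := r * cos θ) ?_ ?_).congr_deriv (by ring)
  · simpa using (hasDerivAt_cos θ).const_mul r
  · simpa using (hasDerivAt_sin θ).const_mul r

lemma hasDerivAt_radial {u : EuclideanSpace ℝ (Fin 2) → ℝ} (hu : Differentiable ℝ u) (r θ : ℝ) :
    HasDerivAt (fun t => u (polarPoint t θ))
      (gradient u (polarPoint r θ) 0 * cos θ + gradient u (polarPoint r θ) 1 * sin θ) r := by
  refine hasDerivAt_comp_curve (γ := fun t => polarPoint t θ) hu.differentiableAt ?_ ?_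
  · simpa using (hasDerivAt_id r).mul_const (cos θ)
  · simpa using (hasDerivAt_id r).mul_const (sin θ)

lemma norm_sq_eq_polar (g : EuclideanSpace ℝ (Fin 2)) (θ : ℝ) :
    ‖g‖ ^ 2 = (g 0 * cos θ + g 1 * sin θ) ^ 2 + (g 1 * cos θ - g 0 * sin θ) ^ 2 := by
  rw [EuclideanSpace.norm_sq_eq, Fin.sum_univ_two]
  simp only [Real.norm_eq_abs, sq_abs]
  linear_combination (-(g 0 ^ 2 + g 1 ^ 2)) * sin_sq_add_cos_sq θ

/-- The Hardy inequality with constant `1/4` in the critical sector. -/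
lemma hardy_critical {β : ℝ} (hβ : π ≤ β) (hβ2 : β ≤ 2 * π)
    (htan : tan ((β - π) / 4) = 2 * critSlope) {u : EuclideanSpace ℝ (Fin 2) → ℝ}
    (hu : ContDiff ℝ (⊤ : ℕ∞) u) (hc : HasCompactSupport u) (hs : tsupport u ⊆ sector β) :
    1 / 4 * ∫ x in sector β, u x ^ 2 / Metric.infDist x (sector β)ᶜ ^ 2
      ≤ ∫ x in sector β, ‖gradient u x‖ ^ 2 := by
  have hpi := pi_pos
  set W : EuclideanSpace ℝ (Fin 2) → ℝ := fun x => u x ^ 2 / Metric.infDist x (sector β)ᶜ ^ 2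
    with hW
  have cW : Continuous W := continuous_sq_div_infDist_sq hβ hβ2 hu.continuous hs
  have sW : HasCompactSupport W := hasCompactSupport_sq_div hc _
  have cG := continuous_norm_gradient_sq hu
  have sG := hasCompactSupport_norm_gradient_sq hc
  have hdu : Differentiable ℝ u := hu.differentiable (by simp)
  have iW := cW.integrable_of_hasCompactSupport sW (μ := volume)
  have iG := cG.integrable_of_hasCompactSupport sG (μ := volume)
  have cF : Continuous fun x => ‖gradient u x‖ ^ 2 - 1 / 4 * W x := cG.sub (cW.const_mul _)
  have sF : HasCompactSupport fun x => ‖gradient u x‖ ^ 2 - 1 / 4 * W x :=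
    sG.sub (sW.mul_left (f := fun _ => (1 / 4 : ℝ)))
  suffices h : 0 ≤ ∫ x in sector β, (‖gradient u x‖ ^ 2 - 1 / 4 * W x) by
    rw [integral_sub iG.integrableOn (iW.integrableOn.const_mul _), integral_const_mul] at h
    linarith
  rw [integral_sector_eq_polar hβ2, Measure.volume_eq_prod, setIntegral_prod _ (by
    rw [← Measure.volume_eq_prod]; exact integrableOn_polar cF sF β)]
  refine setIntegral_nonneg measurableSet_Ioi fun r hr => ?_
  rw [Set.mem_Ioi] at hr
  have hev : ∀ᶠ t in nhds (0 : ℝ), u (polarPoint r t) = 0 ∧ u (polarPoint r (β - t)) = 0 := by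
    have aux : ∀ (γ : ℝ → EuclideanSpace ℝ (Fin 2)), Continuous γ → γ 0 ∉ sector β →
        ∀ᶠ t in nhds (0 : ℝ), u (γ t) = 0 := by
      intro γ hγ h0
      have : (tsupport u)ᶜ ∈ nhds (γ 0) :=
        (isClosed_tsupport u).isOpen_compl.mem_nhds fun h => h0 (hs h)
      filter_upwards [hγ.continuousAt.preimage_mem_nhds this] with t ht
      exact image_eq_zero_of_notMem_tsupport ht
    refine (aux (fun t => polarPoint r t) ?_ ?_).and (aux (fun t => polarPoint r (β - t)) ?_ ?_)
    · exact continuous_polarPoint.comp (by fun_prop : Continuous fun t : ℝ => (r, t))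
    · exact polarPoint_notMem_sector hβ2 hr.le ⟨le_rfl, by positivity⟩ (by simp)
    · exact continuous_polarPoint.comp (by fun_prop : Continuous fun t : ℝ => (r, β - t))
    · exact polarPoint_notMem_sector hβ2 hr.le ⟨by simp; linarith, by simpa using hβ2⟩ (by simp)
  obtain ⟨ε, hε, hev⟩ := Metric.eventually_nhds_iff.1 hev
  set a := min (ε / 2) 1 with ha
  have ha0 : 0 < a := by positivity
  have ha1 : a < π / 2 := (min_le_right _ _).trans_lt (by linarith [pi_gt_three])
  have haε : a < ε := (min_le_left _ _).trans_lt (by linarith)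
  have hz : ∀ t, 0 ≤ t → t ≤ a → u (polarPoint r t) = 0 ∧ u (polarPoint r (β - t)) = 0 :=
    fun t h0 h1 => hev (by rw [dist_zero_right, Real.norm_of_nonneg h0]; linarith)
  set f : ℝ → ℝ := fun θ => r * (‖gradient u (polarPoint r θ)‖ ^ 2 - 1 / 4 * W (polarPoint r θ))
    with hf
  have cf : Continuous f := continuous_const.mul
    (cF.comp (continuous_polarPoint.comp (by fun_prop : Continuous fun t : ℝ => (r, t))))
  change 0 ≤ ∫ θ in Set.Ioo 0 β, f θ
  rw [← integral_Ioc_eq_integral_Ioo, ← intervalIntegral.integral_of_le (by linarith),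
    ← intervalIntegral.integral_add_adjacent_intervals (b := a) (cf.intervalIntegrable _ _)
      (cf.intervalIntegrable _ _),
    ← intervalIntegral.integral_add_adjacent_intervals (a := a) (b := β - a)
      (cf.intervalIntegrable _ _) (cf.intervalIntegrable _ _)]
  have n1 : 0 ≤ ∫ θ in (0)..a, f θ := by
    refine intervalIntegral.integral_nonneg ha0.le fun θ hθ => ?_
    simp only [hf, hW, (hz θ hθ.1 hθ.2).1]
    simp only [ne_eq, OfNat.ofNat_ne_zero, not_false_eq_true, zero_pow, zero_div, mul_zero, sub_zero]
    positivity
  have n3 : 0 ≤ ∫ θ in (β - a)..β, f θ := by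
    refine intervalIntegral.integral_nonneg (by linarith) fun θ hθ => ?_
    have := (hz (β - θ) (by linarith [hθ.2]) (by linarith [hθ.1])).2
    rw [sub_sub_cancel] at this
    simp only [hf, hW, this]
    simp only [ne_eq, OfNat.ofNat_ne_zero, not_false_eq_true, zero_pow, zero_div, mul_zero, sub_zero]
    positivity
  have n2 : 0 ≤ ∫ θ in a..(β - a), f θ := by
    set v : ℝ → ℝ := fun θ => u (polarPoint r θ) with hv
    set v' : ℝ → ℝ := fun θ => r * (gradient u (polarPoint r θ) 1 * cos θ
      - gradient u (polarPoint r θ) 0 * sin θ) with hv'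
    have cg : Continuous (gradient u) :=
      (LinearIsometryEquiv.continuous _).comp (hu.continuous_fderiv (by simp))
    have cp : Continuous fun θ => polarPoint r θ :=
      continuous_polarPoint.comp (by fun_prop : Continuous fun t : ℝ => (r, t))
    have cgp : Continuous fun θ => gradient u (polarPoint r θ) := cg.comp cp
    have cv' : Continuous v' := by
      simp only [hv']
      fun_prop
    have cv : Continuous v := hu.continuous.comp cp
    have h1d := angular_hardy hβ hβ2 htan ha0 ha1 (v := v) (v' := v')
      (fun x _ => hasDerivAt_angular hdu r x) cv'.continuousOn (hz a ha0.le le_rfl).1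
      (hz a ha0.le le_rfl).2
    have hle : (1 / r) * ∫ x in a..(β - a), (v' x ^ 2 - 1 / 4 * (v x ^ 2 / angDist β x ^ 2))
        ≤ ∫ θ in a..(β - a), f θ := by
      rw [← intervalIntegral.integral_const_mul]
      refine intervalIntegral.integral_mono_on (by linarith) ?_ (cf.intervalIntegrable _ _) ?_
      · refine ContinuousOn.intervalIntegrable ?_
        rw [Set.uIcc_of_le (by linarith)]
        refine continuousOn_const.mul ((cv'.continuousOn.pow 2).sub (continuousOn_const.mul
          ((cv.continuousOn.pow 2).div ((continuous_angDist β).continuousOn.pow 2) fun x hx => ?_)))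
        have := angDist_pos (β := β) (θ := x) (by linarith [hx.1]) (by linarith [hx.2])
        positivity
      · intro θ hθ
        have h0 : 0 < θ := by linarith [hθ.1]
        have h1 : θ < β := by linarith [hθ.2]
        simp only [hf, hW]
        rw [infDist_sector hβ hβ2 hr h0 h1, norm_sq_eq_polar _ θ]
        have hm := angDist_pos h0 h1
        have e : r * ((gradient u (polarPoint r θ) 0 * cos θ
            + gradient u (polarPoint r θ) 1 * sin θ) ^ 2
            + (gradient u (polarPoint r θ) 1 * cos θ - gradient u (polarPoint r θ) 0 * sin θ) ^ 2
            - 1 / 4 * (u (polarPoint r θ) ^ 2 / (r * angDist β θ) ^ 2))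
            - 1 / r * (v' θ ^ 2 - 1 / 4 * (v θ ^ 2 / angDist β θ ^ 2))
            = r * (gradient u (polarPoint r θ) 0 * cos θ
            + gradient u (polarPoint r θ) 1 * sin θ) ^ 2 := by
          simp only [hv, hv']
          field_simp
          ring
        have : 0 ≤ r * (gradient u (polarPoint r θ) 0 * cos θ
            + gradient u (polarPoint r θ) 1 * sin θ) ^ 2 := by positivity
        linarith
    refine le_trans ?_ hle
    positivity
  linarith

lemma integrableOn_inv_mul_comp_log {f : ℝ → ℝ} (hf : Integrable f) :
    IntegrableOn (fun r => r⁻¹ * f (log r)) (Set.Ioi 0) := by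
  have h := integrableOn_image_iff_integrableOn_abs_deriv_smul (s := Set.univ)
    MeasurableSet.univ (fun x _ => (hasDerivAt_exp x).hasDerivWithinAt) exp_injective.injOn
    (fun r => r⁻¹ * f (log r))
  rw [Set.image_univ, range_exp] at h
  refine h.2 (hf.integrableOn.congr_fun (fun x _ => ?_) MeasurableSet.univ)
  simp only [abs_exp, log_exp, smul_eq_mul]
  field_simp

lemma integral_inv_mul_comp_log (f : ℝ → ℝ) :
    ∫ r in Set.Ioi 0, r⁻¹ * f (log r) = ∫ t, f t := by
  have h := integral_image_eq_integral_abs_deriv_smul (s := Set.univ)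
    MeasurableSet.univ (fun x _ => (hasDerivAt_exp x).hasDerivWithinAt) exp_injective.injOn
    (fun r => r⁻¹ * f (log r))
  rw [Set.image_univ, range_exp] at h
  rw [h, Measure.restrict_univ]
  congr 1 with x
  simp only [abs_exp, log_exp, smul_eq_mul]
  field_simp

lemma setIntegral_log_prod {f₁ f₂ g₁ g₂ : ℝ → ℝ} {s : Set ℝ} (i₁ : Integrable f₁)
    (i₂ : Integrable f₂) (j₁ : IntegrableOn g₁ s) (j₂ : IntegrableOn g₂ s) :
    ∫ p in Set.Ioi (0 : ℝ) ×ˢ s, ((p.1⁻¹ * f₁ (log p.1)) * g₁ p.2 + (p.1⁻¹ * f₂ (log p.1)) * g₂ p.2)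
      = (∫ t, f₁ t) * (∫ θ in s, g₁ θ) + (∫ t, f₂ t) * ∫ θ in s, g₂ θ := by
  have k₁ := integrableOn_inv_mul_comp_log i₁
  have k₂ := integrableOn_inv_mul_comp_log i₂
  rw [Measure.volume_eq_prod, ← Measure.prod_restrict, integral_add (k₁.integrable.mul_prod j₁)
    (k₂.integrable.mul_prod j₂), integral_prod_mul (fun r => r⁻¹ * f₁ (log r)) g₁,
    integral_prod_mul (fun r => r⁻¹ * f₂ (log r)) g₂, integral_inv_mul_comp_log,
    integral_inv_mul_comp_log]

lemma integrable_sq_of_hasCompactSupport {f : ℝ → ℝ} (hf : Continuous f)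
    (hc : HasCompactSupport f) : Integrable fun t => f t ^ 2 :=
  (hf.pow 2).integrable_of_hasCompactSupport (hc.mono fun t ht h0 => ht (by simp [h0]))

/-- The function on the plane equal to `h (log r) * ψ θ` in polar coordinates. -/
noncomputable def polarTest (h ψ : ℝ → ℝ) (x : EuclideanSpace ℝ (Fin 2)) : ℝ :=
  h (Complex.log (negComplex x)).re * ψ ((Complex.log (negComplex x)).im + π)

lemma polarTest_polarPoint (h ψ : ℝ → ℝ) {r θ : ℝ} (hr : 0 < r) (hθ : θ ∈ Set.Ioc 0 (2 * π)) :
    polarTest h ψ (polarPoint r θ) = h (log r) * ψ θ := by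
  rw [polarTest, Complex.log_re, Complex.log_im, norm_negComplex_polarPoint hr.le,
    arg_negComplex_polarPoint hr hθ, sub_add_cancel]

lemma contDiff_negComplex : ContDiff ℝ (⊤ : ℕ∞) negComplex := by
  have : negComplex = fun x => ((-x 0 : ℝ) : ℂ) + ((-x 1 : ℝ) : ℂ) * Complex.I := by
    ext x; apply Complex.ext <;> simp [negComplex]
  rw [this]
  have e : ∀ i, ContDiff ℝ (⊤ : ℕ∞) fun x : EuclideanSpace ℝ (Fin 2) => x i := fun i => by fun_prop
  have o : ContDiff ℝ (⊤ : ℕ∞) (fun t : ℝ => (t : ℂ)) := Complex.ofRealCLM.contDiff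
  exact (o.comp (e 0).neg).add ((o.comp (e 1).neg).mul contDiff_const)

section TestFunction

variable {h ψ : ℝ → ℝ} {S a b β : ℝ}

lemma exists_of_polarTest_ne_zero (hh0 : ∀ t ∉ Set.Ioo 0 S, h t = 0)
    (hψ0 : ∀ t ∉ Set.Icc a b, ψ t = 0) {x : EuclideanSpace ℝ (Fin 2)}
    (hx : polarTest h ψ x ≠ 0) :
    x ∈ (fun p : ℝ × ℝ => polarPoint p.1 p.2) '' (Set.Icc 1 (exp S) ×ˢ Set.Icc a b) := by
  rw [polarTest, Complex.log_re, Complex.log_im] at hx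
  have h1 : log ‖negComplex x‖ ∈ Set.Ioo 0 S := by
    by_contra hn; exact hx (by rw [hh0 _ hn, zero_mul])
  have h2 : (negComplex x).arg + π ∈ Set.Icc a b := by
    by_contra hn; exact hx (by rw [hψ0 _ hn, mul_zero])
  have hpos : 0 < ‖negComplex x‖ := by
    rcases (norm_nonneg (negComplex x)).eq_or_lt with h | h
    · rw [← h] at h1; simp at h1
    · exact h
  refine ⟨(‖negComplex x‖, (negComplex x).arg + π), ⟨⟨?_, ?_⟩, h2⟩, polarPoint_negComplex x⟩
  · exact (log_nonneg_iff hpos).1 h1.1.le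
  · exact (log_le_iff_le_exp hpos).1 h1.2.le

lemma isCompact_polarRect (S a b : ℝ) : IsCompact
    ((fun p : ℝ × ℝ => polarPoint p.1 p.2) '' (Set.Icc 1 (exp S) ×ˢ Set.Icc a b)) :=
  (isCompact_Icc.prod isCompact_Icc).image continuous_polarPoint

lemma polarRect_subset (ha : 0 < a) (hb : b < β) :
    (fun p : ℝ × ℝ => polarPoint p.1 p.2) '' (Set.Icc 1 (exp S) ×ˢ Set.Icc a b) ⊆ sector β := by
  rintro _ ⟨⟨r, θ⟩, ⟨h1, h2⟩, rfl⟩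
  exact polarPoint_mem_sector (zero_lt_one.trans_le h1.1) (ha.trans_le h2.1) (h2.2.trans_lt hb)

lemma tsupport_polarTest_subset (hh0 : ∀ t ∉ Set.Ioo 0 S, h t = 0)
    (hψ0 : ∀ t ∉ Set.Icc a b, ψ t = 0) : tsupport (polarTest h ψ) ⊆
      (fun p : ℝ × ℝ => polarPoint p.1 p.2) '' (Set.Icc 1 (exp S) ×ˢ Set.Icc a b) :=
  closure_minimal (fun _ hx => exists_of_polarTest_ne_zero hh0 hψ0 hx)
    (isCompact_polarRect S a b).isClosed

lemma contDiff_polarTest (hβ2 : β ≤ 2 * π) (ha : 0 < a) (hb : b < β)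
    (hh : ContDiff ℝ (⊤ : ℕ∞) h) (hh0 : ∀ t ∉ Set.Ioo 0 S, h t = 0)
    (hψ : ContDiff ℝ (⊤ : ℕ∞) ψ) (hψ0 : ∀ t ∉ Set.Icc a b, ψ t = 0) :
    ContDiff ℝ (⊤ : ℕ∞) (polarTest h ψ) := by
  refine contDiff_iff_contDiffAt.2 fun x => ?_
  by_cases hx : x ∈ tsupport (polarTest h ψ)
  swap
  · exact contDiffAt_const.congr_of_eventuallyEq (notMem_tsupport_iff_eventuallyEq.1 hx)
  obtain ⟨⟨r, θ⟩, ⟨h1, h2⟩, rfl⟩ := tsupport_polarTest_subset hh0 hψ0 hx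
  have hr : 0 < r := zero_lt_one.trans_le h1.1
  have hθ0 : 0 < θ := ha.trans_le h2.1
  have hθ : θ < 2 * π := (h2.2.trans_lt hb).trans_le hβ2
  have hs : negComplex (polarPoint r θ) ∈ Complex.slitPlane := by
    rw [Complex.mem_slitPlane_iff_arg, arg_negComplex_polarPoint hr ⟨hθ0, hθ.le⟩]
    refine ⟨by intro h; linarith, fun h => ?_⟩
    have := norm_negComplex_polarPoint hr.le θ
    rw [h, norm_zero] at this
    exact hr.ne this
  have hL : ContDiffAt ℝ (⊤ : ℕ∞) (fun x => Complex.log (negComplex x)) (polarPoint r θ) :=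
    ((Complex.contDiffAt_log hs).restrict_scalars ℝ).comp _ contDiff_negComplex.contDiffAt
  have hre : ContDiff ℝ (⊤ : ℕ∞) Complex.re := Complex.reCLM.contDiff
  have him : ContDiff ℝ (⊤ : ℕ∞) Complex.im := Complex.imCLM.contDiff
  exact (hh.contDiffAt.comp _ (hre.contDiffAt.comp _ hL)).mul
    (hψ.contDiffAt.comp _ ((him.contDiffAt.comp _ hL).add contDiffAt_const))

lemma continuous_sq_div_angDist_sq (ha : 0 < a) (hb : b < β) (hψ : Continuous ψ)
    (hψ0 : ∀ t ∉ Set.Icc a b, ψ t = 0) : Continuous fun θ => ψ θ ^ 2 / angDist β θ ^ 2 := by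
  rw [continuous_iff_continuousAt]
  intro x
  by_cases hx : x ∈ Set.Icc a b
  · have := angDist_pos (ha.trans_le hx.1) (hx.2.trans_lt hb)
    exact (hψ.continuousAt.pow 2).div ((continuous_angDist β).continuousAt.pow 2) (by positivity)
  · have h : (fun θ => ψ θ ^ 2 / angDist β θ ^ 2) =ᶠ[nhds x] fun _ => 0 := by
      filter_upwards [isClosed_Icc.isOpen_compl.mem_nhds hx] with y hy
      rw [hψ0 y hy]; simp
    exact continuousAt_const.congr h.symm

lemma polar_integrand_polarTest (hβ : π ≤ β) (hβ2 : β ≤ 2 * π) (c : ℝ)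
    (hdh : Differentiable ℝ h) (hdψ : Differentiable ℝ ψ) (hdu : Differentiable ℝ (polarTest h ψ))
    {r θ : ℝ} (hr : 0 < r) (hθ : θ ∈ Set.Ioo 0 β) :
    r * (‖gradient (polarTest h ψ) (polarPoint r θ)‖ ^ 2 - c * (polarTest h ψ (polarPoint r θ) ^ 2
        / Metric.infDist (polarPoint r θ) (sector β)ᶜ ^ 2))
      = (r⁻¹ * deriv h (log r) ^ 2) * ψ θ ^ 2
        + (r⁻¹ * h (log r) ^ 2) * (deriv ψ θ ^ 2 - c * (ψ θ ^ 2 / angDist β θ ^ 2)) := by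
  have hm := angDist_pos hθ.1 hθ.2
  have e1 : gradient (polarTest h ψ) (polarPoint r θ) 0 * cos θ + gradient (polarTest h ψ) (polarPoint r θ) 1 * sin θ
      = deriv h (log r) * r⁻¹ * ψ θ := by
    refine (hasDerivAt_radial hdu r θ).unique ?_
    have := (((hdh (log r)).hasDerivAt.comp r (hasDerivAt_log hr.ne'))).mul_const (ψ θ)
    refine this.congr_of_eventuallyEq ?_
    filter_upwards [lt_mem_nhds hr] with t ht
    exact polarTest_polarPoint h ψ ht ⟨hθ.1, hθ.2.le.trans hβ2⟩
  have e2 : r * (gradient (polarTest h ψ) (polarPoint r θ) 1 * cos θ - gradient (polarTest h ψ) (polarPoint r θ) 0 * sin θ)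
      = h (log r) * deriv ψ θ := by
    refine (hasDerivAt_angular hdu r θ).unique ?_
    refine ((hdψ θ).hasDerivAt.const_mul (h (log r))).congr_of_eventuallyEq ?_
    filter_upwards [Ioo_mem_nhds hθ.1 hθ.2] with t ht
    exact polarTest_polarPoint h ψ hr ⟨ht.1, ht.2.le.trans hβ2⟩
  have e3 : gradient (polarTest h ψ) (polarPoint r θ) 1 * cos θ
      - gradient (polarTest h ψ) (polarPoint r θ) 0 * sin θ = r⁻¹ * (h (log r) * deriv ψ θ) := by
    rw [← e2, inv_mul_cancel_left₀ hr.ne']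
  rw [norm_sq_eq_polar _ θ, e1, e3, infDist_sector hβ hβ2 hr hθ.1 hθ.2,
    polarTest_polarPoint h ψ hr ⟨hθ.1, hθ.2.le.trans hβ2⟩]
  field_simp
  ring

/-- Testing the Hardy inequality against a product function in polar coordinates. -/
lemma hardy_product_test (hβ : π ≤ β) (hβ2 : β ≤ 2 * π) {c : ℝ}
    (hc : ∀ u : EuclideanSpace ℝ (Fin 2) → ℝ,
      ContDiff ℝ (⊤ : ℕ∞) u → HasCompactSupport u → tsupport u ⊆ sector β →
      c * ∫ x in sector β, u x ^ 2 / Metric.infDist x (sector β)ᶜ ^ 2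
        ≤ ∫ x in sector β, ‖gradient u x‖ ^ 2)
    (ha : 0 < a) (hb : b < β)
    (hh : ContDiff ℝ (⊤ : ℕ∞) h) (hh0 : ∀ t ∉ Set.Ioo 0 S, h t = 0)
    (hψ : ContDiff ℝ (⊤ : ℕ∞) ψ) (hψ0 : ∀ t ∉ Set.Icc a b, ψ t = 0) :
    0 ≤ (∫ t, deriv h t ^ 2) * (∫ θ in Set.Ioo 0 β, ψ θ ^ 2)
      + (∫ t, h t ^ 2) * ∫ θ in Set.Ioo 0 β,
        (deriv ψ θ ^ 2 - c * (ψ θ ^ 2 / angDist β θ ^ 2)) := by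
  set u := polarTest h ψ with hu_def
  have hu : ContDiff ℝ (⊤ : ℕ∞) u := contDiff_polarTest hβ2 ha hb hh hh0 hψ hψ0
  have hts : tsupport u ⊆ _ := tsupport_polarTest_subset hh0 hψ0
  have hcs : HasCompactSupport u :=
    HasCompactSupport.of_support_subset_isCompact (isCompact_polarRect S a b)
      ((subset_tsupport u).trans hts)
  have hss : tsupport u ⊆ sector β := hts.trans (polarRect_subset ha hb)
  set W : EuclideanSpace ℝ (Fin 2) → ℝ := fun x => u x ^ 2 / Metric.infDist x (sector β)ᶜ ^ 2
    with hW
  have cW : Continuous W := continuous_sq_div_infDist_sq hβ hβ2 hu.continuous hss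
  have sW : HasCompactSupport W := hasCompactSupport_sq_div hcs _
  have cG := continuous_norm_gradient_sq hu
  have sG := hasCompactSupport_norm_gradient_sq hcs
  have hdu : Differentiable ℝ u := hu.differentiable (by simp)
  have iW := cW.integrable_of_hasCompactSupport sW (μ := volume)
  have iG := cG.integrable_of_hasCompactSupport sG (μ := volume)
  have key : 0 ≤ ∫ x in sector β, (‖gradient u x‖ ^ 2 - c * W x) := by
    rw [integral_sub iG.integrableOn (iW.integrableOn.const_mul _), integral_const_mul]
    linarith [hc u hu hcs hss]
  rw [integral_sector_eq_polar hβ2] at key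
  rw [setIntegral_congr_fun (measurableSet_Ioi.prod measurableSet_Ioo)
    fun p hp => polar_integrand_polarTest hβ hβ2 c
      (hh.differentiable (by simp)) (hψ.differentiable (by simp)) hdu hp.1 hp.2] at key
  have hhc : HasCompactSupport h := HasCompactSupport.intro (K := Set.Icc 0 S) isCompact_Icc
    fun t ht => hh0 t fun h => ht (Set.Ioo_subset_Icc_self h)
  have i1 := integrable_sq_of_hasCompactSupport (hh.continuous_deriv (by simp)) hhc.deriv
  have i2 := integrable_sq_of_hasCompactSupport hh.continuous hhc
  have j1 : IntegrableOn (fun θ => ψ θ ^ 2) (Set.Ioo 0 β) :=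
    ((hψ.continuous.pow 2).integrableOn_Icc (a := 0) (b := β)).mono_set Set.Ioo_subset_Icc_self
  have j2 : IntegrableOn (fun θ => deriv ψ θ ^ 2 - c * (ψ θ ^ 2 / angDist β θ ^ 2))
      (Set.Ioo 0 β) :=
    ((((hψ.continuous_deriv (by simp)).pow 2).sub (continuous_const.mul
      (continuous_sq_div_angDist_sq ha hb hψ.continuous hψ0))).integrableOn_Icc
      (a := 0) (b := β)).mono_set Set.Ioo_subset_Icc_self
  exact key.trans_eq (setIntegral_log_prod i1 i2 j1 j2)

/-- A smooth angular profile of negative energy violates the Hardy inequality. -/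
lemma not_hardy_of_energy_neg (hβ : π ≤ β) (hβ2 : β ≤ 2 * π) {c : ℝ}
    (ha : 0 < a) (hb : b < β)
    (hψ : ContDiff ℝ (⊤ : ℕ∞) ψ) (hψ0 : ∀ t ∉ Set.Icc a b, ψ t = 0)
    (hE : ∫ θ in Set.Ioo 0 β, (deriv ψ θ ^ 2 - c * (ψ θ ^ 2 / angDist β θ ^ 2)) < 0) :
    ¬ ∀ u : EuclideanSpace ℝ (Fin 2) → ℝ,
      ContDiff ℝ (⊤ : ℕ∞) u → HasCompactSupport u → tsupport u ⊆ sector β →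
      c * ∫ x in sector β, u x ^ 2 / Metric.infDist x (sector β)ᶜ ^ 2
        ≤ ∫ x in sector β, ‖gradient u x‖ ^ 2 := by
  intro hc
  set E := ∫ θ in Set.Ioo 0 β, (deriv ψ θ ^ 2 - c * (ψ θ ^ 2 / angDist β θ ^ 2)) with hEdef
  set P := ∫ θ in Set.Ioo 0 β, ψ θ ^ 2 with hP
  let k : ContDiffBump (2 : ℝ) := ⟨1 / 2, 1, by norm_num, by norm_num⟩
  have kc : ContDiff ℝ (⊤ : ℕ∞) k := k.contDiff
  have kd : Differentiable ℝ k := kc.differentiable (by simp)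
  have k0 : ∀ t ∉ Set.Ioo (1 : ℝ) 3, k t = 0 := by
    intro t ht
    refine k.zero_of_le_dist ?_
    by_contra hlt
    rw [not_le, Real.dist_eq, abs_lt] at hlt
    have : k.rOut = 1 := rfl
    rw [this] at hlt
    exact ht ⟨by linarith [hlt.1], by linarith [hlt.2]⟩
  have hkpos : 0 < ∫ t, k t ^ 2 := by
    have hcont : Continuous fun t => k t ^ 2 := kc.continuous.pow 2
    refine hcont.integral_pos_of_hasCompactSupport_nonneg_nonzero
      (k.hasCompactSupport.comp_left (g := fun y : ℝ => y ^ 2) (by simp))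
      (fun t => sq_nonneg _) (x := 2) ?_
    have : k 2 = 1 := k.one_of_mem_closedBall (Metric.mem_closedBall_self k.rIn_pos.le)
    simp [this]
  set A := ∫ t, deriv k t ^ 2 with hA
  set B := ∫ t, k t ^ 2 with hB
  have hA0 : 0 ≤ A := integral_nonneg fun t => sq_nonneg _
  have hP0 : 0 ≤ P := integral_nonneg fun t => sq_nonneg _
  have main : ∀ R : ℝ, 0 < R → 0 ≤ (R⁻¹ * A) * P + (R * B) * E := by
    intro R hR
    have h1 := hardy_product_test hβ hβ2 hc ha hb (h := fun t => k (t / R)) (S := 3 * R)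
      (kc.comp (contDiff_id.div_const R)) (fun t ht => k0 _ fun hm => ht ⟨?_, ?_⟩) hψ hψ0
    · have e1 : ∫ t, deriv (fun t => k (t / R)) t ^ 2 = R⁻¹ * A := by
        have : ∀ t, deriv (fun t => k (t / R)) t ^ 2 = (R⁻¹) ^ 2 * deriv k (t / R) ^ 2 := by
          intro t
          have := ((kd (t / R)).hasDerivAt.comp t ((hasDerivAt_id t).div_const R)).deriv
          have e : deriv (fun t => k (t / R)) t = deriv k (t / R) * (1 / R) := this
          rw [e]; ring
        simp only [this]
        rw [integral_const_mul, Measure.integral_comp_div (fun t => deriv k t ^ 2), abs_of_pos hR,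
          smul_eq_mul, ← hA]
        field_simp
      have e2 : ∫ t, (k (t / R)) ^ 2 = R * B := by
        rw [Measure.integral_comp_div (fun t => k t ^ 2), abs_of_pos hR, smul_eq_mul]
      rw [e1, e2] at h1
      exact h1
    · have := hm.1
      rw [lt_div_iff₀ hR] at this; linarith
    · have := hm.2
      rw [div_lt_iff₀ hR] at this; linarith
  have hBE : 0 < B * (-E) := mul_pos hkpos (by linarith)
  set R := 1 + A * P / (B * (-E)) with hRdef
  have hq : 0 ≤ A * P / (B * (-E)) := by positivity
  have hR1 : 1 ≤ R := by linarith
  have h2 := main R (by linarith)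
  have h3 : A * P = (R - 1) * (B * (-E)) := by
    rw [hRdef, add_sub_cancel_left, div_mul_cancel₀ _ hBE.ne']
  have h4 : R * ((R⁻¹ * A) * P + (R * B) * E) = A * P - R ^ 2 * (B * (-E)) := by
    field_simp; ring
  have h5 : 0 ≤ A * P - R ^ 2 * (B * (-E)) := by rw [← h4]; exact mul_nonneg (by linarith) h2
  rw [h3] at h5
  have h6 : 0 < (R ^ 2 - R + 1) * (B * (-E)) := mul_pos (by nlinarith) hBE
  linarith

end TestFunction

section Mollification

variable {p : ℝ → ℝ} {a b β M ε : ℝ}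

lemma integrable_of_bounded_of_support (hpm : AEStronglyMeasurable p) (hM : ∀ x, |p x| ≤ M)
    (hp0 : ∀ x ∉ Set.Icc a b, p x = 0) : Integrable p := by
  have h : IntegrableOn p (Set.Icc a b) :=
    Measure.integrableOn_of_bounded (M := M) (by simp) hpm (ae_of_all _ fun x => hM x)
  exact (integrableOn_iff_integrable_of_support_subset fun x hx => by
    by_contra hn; exact hx (hp0 x hn)).1 h

/-- Convolution of `p` with a normalised bump function. -/
noncomputable def mollify (φ : ContDiffBump (0 : ℝ)) (p : ℝ → ℝ) : ℝ → ℝ :=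
  convolution (φ.normed volume) p (ContinuousLinearMap.lsmul ℝ ℝ) volume

lemma contDiff_mollify (φ : ContDiffBump (0 : ℝ)) (hp : Integrable p) :
    ContDiff ℝ (⊤ : ℕ∞) (mollify φ p) :=
  φ.hasCompactSupport_normed.contDiff_convolution_left _ φ.contDiff_normed
    hp.locallyIntegrable

lemma abs_mollify_le (φ : ContDiffBump (0 : ℝ)) (hM : ∀ x, |p x| ≤ M) (x : ℝ) :
    |mollify φ p x| ≤ M := by
  have h : ‖∫ t, φ.normed volume t • p (x - t)‖ ≤ ∫ t, φ.normed volume t * M := by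
    refine norm_integral_le_of_norm_le (φ.integrable_normed.mul_const M) (ae_of_all _ fun t => ?_)
    rw [norm_smul, Real.norm_of_nonneg (φ.nonneg_normed t)]
    exact mul_le_mul_of_nonneg_left (hM _) (φ.nonneg_normed t)
  rw [integral_mul_const, φ.integral_normed, one_mul] at h
  exact h

lemma mollify_eq_zero (φ : ContDiffBump (0 : ℝ)) (hφ : φ.rOut ≤ ε)
    (hp0 : ∀ x ∉ Set.Icc a b, p x = 0) {x : ℝ} (hx : x ∉ Set.Icc (a - ε) (b + ε)) :
    mollify φ p x = 0 := by
  have : ∀ t, φ.normed volume t • p (x - t) = 0 := by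
    intro t
    by_cases ht : φ.normed volume t = 0
    · simp [ht]
    · have h1 : t ∈ Function.support (φ.normed volume) := ht
      rw [φ.support_normed_eq, Metric.mem_ball, dist_zero_right, Real.norm_eq_abs, abs_lt] at h1
      rw [hp0 _ fun h => hx ⟨by linarith [h.1], by linarith [h.2]⟩, smul_zero]
  change ∫ t, φ.normed volume t • p (x - t) = 0
  simp only [this, integral_zero]

lemma integral_mollify (φ : ContDiffBump (0 : ℝ)) (hp : Integrable p) :
    ∫ x, mollify φ p x = ∫ x, p x := by
  have := integral_convolution (ContinuousLinearMap.lsmul ℝ ℝ)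
    (φ.integrable_normed (μ := volume)) hp
  rw [φ.integral_normed] at this
  simpa [mollify] using this

lemma primitive_eq_zero (ha : 0 < a) (hp0 : ∀ x ∉ Set.Icc a b, p x = 0)
    (hzero : ∫ x, p x = 0) {x : ℝ} (hx : x ∉ Set.Icc a b) : ∫ t in (0)..x, p t = 0 := by
  by_cases h : x < a
  · refine (intervalIntegral.integral_congr fun t ht => ?_).trans intervalIntegral.integral_zero
    refine hp0 t fun hm => ?_
    have : max 0 x < a := max_lt ha h
    exact absurd (ht.2.trans_lt this) (not_lt.2 hm.1)
  · have hbx : b < x := by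
      by_contra hn; exact hx ⟨not_lt.1 h, not_lt.1 hn⟩
    rw [not_lt] at h
    rw [intervalIntegral.integral_of_le (ha.le.trans h)]
    refine Eq.trans ?_ hzero
    refine setIntegral_eq_integral_of_forall_compl_eq_zero fun t ht => hp0 t fun hm => ht ?_
    exact ⟨ha.trans_le hm.1, hm.2.trans hbx.le⟩

lemma contDiff_primitive (hp : ContDiff ℝ (⊤ : ℕ∞) p) :
    ContDiff ℝ (⊤ : ℕ∞) fun x => ∫ t in (0)..x, p t := by
  have hd : ∀ x, HasDerivAt (fun x => ∫ t in (0)..x, p t) (p x) x := fun x =>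
    intervalIntegral.integral_hasDerivAt_right (hp.continuous.intervalIntegrable _ _)
      hp.continuous.stronglyMeasurable.stronglyMeasurableAtFilter hp.continuous.continuousAt
  rw [contDiff_infty_iff_deriv]
  refine ⟨fun x => (hd x).differentiableAt, ?_⟩
  have : deriv (fun x => ∫ t in (0)..x, p t) = p := funext fun x => (hd x).deriv
  rwa [this]

/-- A Lipschitz angular profile of negative energy violates the Hardy inequality. -/
lemma not_hardy_of_bounded_deriv (hβ : π ≤ β) (hβ2 : β ≤ 2 * π) {c : ℝ}
    (ha : 0 < a) (hab : a ≤ b) (hb : b < β) (hpm : AEStronglyMeasurable p)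
    (hM : ∀ x, |p x| ≤ M) (hp0 : ∀ x ∉ Set.Icc a b, p x = 0) (hzero : ∫ x, p x = 0)
    (hE : ∫ θ in Set.Ioo 0 β, (p θ ^ 2 - c * ((∫ t in (0)..θ, p t) ^ 2 / angDist β θ ^ 2)) < 0) :
    ¬ ∀ u : EuclideanSpace ℝ (Fin 2) → ℝ,
      ContDiff ℝ (⊤ : ℕ∞) u → HasCompactSupport u → tsupport u ⊆ sector β →
      c * ∫ x in sector β, u x ^ 2 / Metric.infDist x (sector β)ᶜ ^ 2
        ≤ ∫ x in sector β, ‖gradient u x‖ ^ 2 := by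
  have hM0 : 0 ≤ M := (abs_nonneg _).trans (hM 0)
  have hpi := integrable_of_bounded_of_support hpm hM hp0
  obtain ⟨ε, hε, hεa, hεb⟩ : ∃ ε : ℝ, 0 < ε ∧ 0 < a - ε ∧ b + ε < β :=
    ⟨min a (β - b) / 2, by have := sub_pos.2 hb; positivity,
      by linarith [min_le_left a (β - b)], by linarith [min_le_right a (β - b)]⟩
  let φ : ℕ → ContDiffBump (0 : ℝ) := fun n =>
    ⟨ε / (n + 1) / 2, ε / (n + 1), by positivity, half_lt_self (by positivity)⟩
  have hφε : ∀ n, (φ n).rOut ≤ ε := fun n => div_le_self hε.le (by linarith [n.cast_nonneg (α := ℝ)])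
  have hφt : Filter.Tendsto (fun n => (φ n).rOut) Filter.atTop (nhds 0) := by
    have := (tendsto_one_div_add_atTop_nhds_zero_nat (𝕜 := ℝ)).const_mul ε
    rw [mul_zero] at this
    refine this.congr fun n => ?_
    change ε * (1 / ((n : ℝ) + 1)) = ε / (n + 1)
    ring
  have hlim : ∀ᵐ x, Filter.Tendsto (fun n => mollify (φ n) p x) Filter.atTop (nhds (p x)) :=
    ContDiffBump.ae_convolution_tendsto_right_of_locallyIntegrable (K := 2) hφt
      (Filter.Eventually.of_forall fun n => by
        change ε / ((n : ℝ) + 1) ≤ 2 * (ε / (n + 1) / 2)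
        linarith) hpi.locallyIntegrable
  set q : ℕ → ℝ → ℝ := fun n => mollify (φ n) p with hq
  have hqs : ∀ n, ContDiff ℝ (⊤ : ℕ∞) (q n) := fun n => contDiff_mollify (φ n) hpi
  have hqM : ∀ n x, |q n x| ≤ M := fun n x => abs_mollify_le (φ n) hM x
  have hq0 : ∀ n, ∀ x ∉ Set.Icc (a - ε) (b + ε), q n x = 0 :=
    fun n x hx => mollify_eq_zero (φ n) (hφε n) hp0 hx
  have hqint : ∀ n, ∫ x, q n x = 0 := fun n => (integral_mollify (φ n) hpi).trans hzero
  set ψ : ℕ → ℝ → ℝ := fun n x => ∫ t in (0)..x, q n t with hψ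
  have hψs : ∀ n, ContDiff ℝ (⊤ : ℕ∞) (ψ n) := fun n => contDiff_primitive (hqs n)
  have hψd : ∀ n x, deriv (ψ n) x = q n x := fun n x =>
    (intervalIntegral.integral_hasDerivAt_right ((hqs n).continuous.intervalIntegrable _ _)
      (hqs n).continuous.stronglyMeasurable.stronglyMeasurableAtFilter
      (hqs n).continuous.continuousAt).deriv
  have hψ0 : ∀ n, ∀ x ∉ Set.Icc (a - ε) (b + ε), ψ n x = 0 :=
    fun n x hx => primitive_eq_zero hεa (hq0 n) (hqint n) hx
  have hψlim : ∀ x, Filter.Tendsto (fun n => ψ n x) Filter.atTop (nhds (∫ t in (0)..x, p t)) := by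
    intro x
    refine intervalIntegral.tendsto_integral_filter_of_dominated_convergence (fun _ => M)
      (Filter.Eventually.of_forall fun n => (hqs n).continuous.aestronglyMeasurable)
      (Filter.Eventually.of_forall fun n => ae_of_all _ fun t _ => hqM n t)
      (by simp) ?_
    filter_upwards [hlim] with t ht _ using ht
  have hψb : ∀ n, ∀ x ∈ Set.Ioo 0 β, |ψ n x| ≤ M * β := by
    intro n x hx
    have := intervalIntegral.norm_integral_le_of_norm_le_const (a := 0) (b := x) (f := q n)
      (C := M) fun t _ => hqM n t
    rw [sub_zero, abs_of_pos hx.1] at this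
    exact this.trans (mul_le_mul_of_nonneg_left hx.2.le hM0)
  obtain ⟨m, hm, hmle⟩ : ∃ m, 0 < m ∧ ∀ x ∈ Set.Icc (a - ε) (b + ε), m ≤ angDist β x := by
    obtain ⟨x₀, hx₀, hmin⟩ := isCompact_Icc.exists_isMinOn
      (Set.nonempty_Icc.2 (show a - ε ≤ b + ε by linarith)) (continuous_angDist β).continuousOn
    exact ⟨angDist β x₀, angDist_pos (by linarith [hx₀.1]) (by linarith [hx₀.2]), hmin⟩
  have hW : ∀ n, ∀ x ∈ Set.Ioo 0 β, ψ n x ^ 2 / angDist β x ^ 2 ≤ (M * β) ^ 2 / m ^ 2 := by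
    intro n x hx
    by_cases h : x ∈ Set.Icc (a - ε) (b + ε)
    · have h1 := hmle x h
      have h2 : ψ n x ^ 2 ≤ (M * β) ^ 2 := by
        rw [← sq_abs]; exact pow_le_pow_left₀ (abs_nonneg _) (hψb n x hx) 2
      gcongr
    · rw [hψ0 n x h]
      simp only [ne_eq, OfNat.ofNat_ne_zero, not_false_eq_true, zero_pow, zero_div]
      positivity
  have hconv : Filter.Tendsto (fun n => ∫ θ in Set.Ioo 0 β,
      (deriv (ψ n) θ ^ 2 - c * (ψ n θ ^ 2 / angDist β θ ^ 2))) Filter.atTop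
      (nhds (∫ θ in Set.Ioo 0 β,
        (p θ ^ 2 - c * ((∫ t in (0)..θ, p t) ^ 2 / angDist β θ ^ 2)))) := by
    refine tendsto_integral_of_dominated_convergence
      (fun _ => M ^ 2 + |c| * ((M * β) ^ 2 / m ^ 2)) (fun n => ?_) ?_ (fun n => ?_) ?_
    · simp only [hψd]
      exact (((hqs n).continuous.pow 2).sub (continuous_const.mul
        (continuous_sq_div_angDist_sq hεa hεb (hψs n).continuous (hψ0 n)))).aestronglyMeasurable
    · simp
    · refine (ae_restrict_iff' measurableSet_Ioo).2 (ae_of_all _ fun x hx => ?_)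
      rw [hψd]
      refine (norm_sub_le _ _).trans (add_le_add ?_ ?_)
      · rw [norm_pow, Real.norm_eq_abs]
        exact pow_le_pow_left₀ (abs_nonneg _) (hqM n x) 2
      · rw [norm_mul, Real.norm_eq_abs, Real.norm_of_nonneg (by positivity)]
        exact mul_le_mul_of_nonneg_left (hW n x hx) (abs_nonneg c)
    · refine ae_restrict_of_ae ?_
      filter_upwards [hlim] with x hx
      simp only [hψd]
      exact (hx.pow 2).sub ((((hψlim x).pow 2).div_const _).const_mul c)
  obtain ⟨n, hn⟩ := (hconv.eventually (gt_mem_nhds hE)).exists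
  exact not_hardy_of_energy_neg hβ hβ2 hεa hεb (hψs n) (hψ0 n) hn

end Mollification

/-- There is a Lipschitz profile on `[a, b]` with boundary values `A`, `B` and energy `E`, where
the energy is `∫ (ψ'² - c ψ² / angDist²)`. -/
def HasProfile (β c a b A B E : ℝ) : Prop :=
  ∃ p ψ : ℝ → ℝ, AEStronglyMeasurable p ∧ (∃ M, ∀ x, |p x| ≤ M) ∧ (∀ x ∉ Set.Ioc a b, p x = 0) ∧
    (∀ x ∈ Set.Icc a b, ∫ t in a..x, p t = ψ x - ψ a) ∧
    IntervalIntegrable (fun x => p x ^ 2 - c * (ψ x ^ 2 / angDist β x ^ 2)) volume a b ∧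
    ψ a = A ∧ ψ b = B ∧ ∫ x in a..b, (p x ^ 2 - c * (ψ x ^ 2 / angDist β x ^ 2)) = E

section Profile

variable {β c a b d A B D₀ E E' : ℝ}

lemma intervalIntegrable_of_bounded_of_support {p : ℝ → ℝ} (hpm : AEStronglyMeasurable p)
    (hM : ∃ M, ∀ x, |p x| ≤ M) (hp0 : ∀ x ∉ Set.Ioc a b, p x = 0) (x y : ℝ) :
    IntervalIntegrable p volume x y := by
  obtain ⟨M, hM⟩ := hM
  exact (integrable_of_bounded_of_support hpm hM (a := a) (b := b) fun x hx =>
    hp0 x fun h => hx (Set.Ioc_subset_Icc_self h)).intervalIntegrable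

lemma HasProfile.trans (hab : a ≤ b) (hbd : b ≤ d) (h₁ : HasProfile β c a b A B E)
    (h₂ : HasProfile β c b d B D₀ E') : HasProfile β c a d A D₀ (E + E') := by
  obtain ⟨p₁, ψ₁, m₁, B₁, z₁, i₁, j₁, a₁, b₁, e₁⟩ := h₁
  obtain ⟨p₂, ψ₂, m₂, B₂, z₂, i₂, j₂, a₂, b₂, e₂⟩ := h₂
  have I₁ := intervalIntegrable_of_bounded_of_support m₁ B₁ z₁
  have I₂ := intervalIntegrable_of_bounded_of_support m₂ B₂ z₂
  set ψ : ℝ → ℝ := fun x => if x ≤ b then ψ₁ x else ψ₂ x with hψ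
  have hψ₁ : ∀ x ≤ b, ψ x = ψ₁ x := fun x hx => if_pos hx
  have hψ₂ : ∀ x, b ≤ x → ψ x = ψ₂ x := by
    intro x hx
    rcases hx.eq_or_lt with rfl | hx
    · rw [hψ₁ _ le_rfl, b₁, a₂]
    · exact if_neg (not_le.2 hx)
  have zero₁ : ∀ x, b < x → p₁ x = 0 := fun x hx => z₁ x fun h => absurd h.2 (not_le.2 hx)
  have zero₂ : ∀ x ≤ b, p₂ x = 0 := fun x hx => z₂ x fun h => absurd h.1 (not_lt.2 hx)
  have int₂ : ∀ x ≤ b, a ≤ x → ∫ t in a..x, p₂ t = 0 := by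
    intro x hx hax
    refine (intervalIntegral.integral_congr fun t ht => ?_).trans intervalIntegral.integral_zero
    rw [Set.uIcc_of_le hax] at ht
    exact zero₂ t (ht.2.trans hx)
  have c₁ : ∀ x ∈ Set.uIoc a b, p₁ x ^ 2 - c * (ψ₁ x ^ 2 / angDist β x ^ 2)
      = (p₁ x + p₂ x) ^ 2 - c * (ψ x ^ 2 / angDist β x ^ 2) := by
    intro x hx
    rw [Set.uIoc_of_le hab] at hx
    rw [hψ₁ x hx.2, zero₂ x hx.2, add_zero]
  have c₂ : ∀ x ∈ Set.uIoc b d, p₂ x ^ 2 - c * (ψ₂ x ^ 2 / angDist β x ^ 2)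
      = (p₁ x + p₂ x) ^ 2 - c * (ψ x ^ 2 / angDist β x ^ 2) := by
    intro x hx
    rw [Set.uIoc_of_le hbd] at hx
    rw [hψ₂ x hx.1.le, zero₁ x hx.1, zero_add]
  have j₁' := j₁.congr c₁
  have j₂' := j₂.congr c₂
  refine ⟨fun x => p₁ x + p₂ x, ψ, m₁.add m₂, ?_, fun x hx => ?_, fun x hx => ?_, j₁'.trans j₂',
    (hψ₁ a hab).trans a₁, (hψ₂ d hbd).trans b₂, ?_⟩
  · obtain ⟨M₁, B₁⟩ := B₁
    obtain ⟨M₂, B₂⟩ := B₂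
    exact ⟨M₁ + M₂, fun x => (abs_add_le _ _).trans (add_le_add (B₁ x) (B₂ x))⟩
  · change p₁ x + p₂ x = 0
    rw [z₁ x fun h => hx ⟨h.1, h.2.trans hbd⟩, z₂ x fun h => hx ⟨hab.trans_lt h.1, h.2⟩, add_zero]
  · rw [intervalIntegral.integral_add (I₁ _ _) (I₂ _ _), hψ₁ a hab]
    rcases le_total x b with hxb | hxb
    · rw [int₂ x hxb hx.1, hψ₁ x hxb, add_zero, i₁ x ⟨hx.1, hxb⟩]
    · rw [← intervalIntegral.integral_add_adjacent_intervals (I₁ a b) (I₁ b x),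
        ← intervalIntegral.integral_add_adjacent_intervals (I₂ a b) (I₂ b x),
        i₁ b ⟨hab, le_rfl⟩, int₂ b le_rfl hab, i₂ x ⟨hxb, hx.2⟩, hψ₂ x hxb,
        intervalIntegral.integral_congr_ae (g := fun _ => 0) (ae_of_all _ fun t ht => ?_),
        intervalIntegral.integral_zero, b₁, a₂]
      · ring
      · rw [Set.uIoc_of_le hxb] at ht
        exact zero₁ t ht.1
  · rw [← intervalIntegral.integral_add_adjacent_intervals j₁' j₂', ← e₁, ← e₂]
    congr 1
    · exact intervalIntegral.integral_congr_ae (ae_of_all _ fun x hx => (c₁ x hx).symm)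
    · exact intervalIntegral.integral_congr_ae (ae_of_all _ fun x hx => (c₂ x hx).symm)

lemma continuousOn_energy {ψ D : ℝ → ℝ} (ha : 0 < a) (hb : b < β)
    (hψ : ∀ x ∈ Set.Icc a b, HasDerivAt ψ (D x) x) (hD : ContinuousOn D (Set.Icc a b)) :
    ContinuousOn (fun x => D x ^ 2 - c * (ψ x ^ 2 / angDist β x ^ 2)) (Set.Icc a b) := by
  have hc : ContinuousOn ψ (Set.Icc a b) := fun x hx => (hψ x hx).continuousAt.continuousWithinAt
  refine (hD.pow 2).sub (continuousOn_const.mul ((hc.pow 2).div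
    ((continuous_angDist β).continuousOn.pow 2) fun x hx => ?_))
  have := angDist_pos (ha.trans_le hx.1) (hx.2.trans_lt hb)
  positivity

lemma hasProfile_of_hasDerivAt {ψ D : ℝ → ℝ} (ha : 0 < a) (hab : a ≤ b) (hb : b < β)
    (hψ : ∀ x ∈ Set.Icc a b, HasDerivAt ψ (D x) x) (hD : ContinuousOn D (Set.Icc a b)) :
    HasProfile β c a b (ψ a) (ψ b) (∫ x in a..b, (D x ^ 2 - c * (ψ x ^ 2 / angDist β x ^ 2))) := by
  have hon : ∀ x ∈ Set.Ioc a b, (Set.Ioc a b).indicator D x = D x :=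
    fun x hx => Set.indicator_of_mem hx D
  refine ⟨(Set.Ioc a b).indicator D, ψ, ?_, ?_, fun x hx => Set.indicator_of_notMem hx D,
    fun x hx => ?_, ?_, rfl, rfl, ?_⟩
  · exact (aestronglyMeasurable_indicator_iff measurableSet_Ioc).2
      ((hD.mono Set.Ioc_subset_Icc_self).aestronglyMeasurable measurableSet_Ioc)
  · obtain ⟨M, hM⟩ := isCompact_Icc.exists_bound_of_continuousOn hD
    refine ⟨M, fun x => ?_⟩
    by_cases hx : x ∈ Set.Ioc a b
    · rw [hon x hx]; exact hM x (Set.Ioc_subset_Icc_self hx)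
    · rw [Set.indicator_of_notMem hx, abs_zero]
      exact (norm_nonneg _).trans (hM a ⟨le_rfl, hab⟩)
  · rw [intervalIntegral.integral_congr_ae (g := D) (ae_of_all _ fun t ht => ?_)]
    · refine intervalIntegral.integral_eq_sub_of_hasDerivAt (fun t ht => ?_) ?_
      · rw [Set.uIcc_of_le hx.1] at ht
        exact hψ t ⟨ht.1, ht.2.trans hx.2⟩
      · refine ContinuousOn.intervalIntegrable ?_
        rw [Set.uIcc_of_le hx.1]
        exact hD.mono (Set.Icc_subset_Icc_right hx.2)
    · rw [Set.uIoc_of_le hx.1] at ht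
      exact hon t ⟨ht.1, ht.2.trans hx.2⟩
  · have h : IntervalIntegrable (fun x => D x ^ 2 - c * (ψ x ^ 2 / angDist β x ^ 2)) volume a b := by
      refine ContinuousOn.intervalIntegrable ?_
      rw [Set.uIcc_of_le hab]
      exact continuousOn_energy ha hb hψ hD
    refine h.congr fun x hx => ?_
    rw [Set.uIoc_of_le hab] at hx
    simp only [hon x hx]
  · refine intervalIntegral.integral_congr_ae (ae_of_all _ fun x hx => ?_)
    rw [Set.uIoc_of_le hab] at hx
    simp only [hon x hx]

lemma hasProfile_of_ode {ψ D : ℝ → ℝ} (ha : 0 < a) (hab : a ≤ b) (hb : b < β)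
    (hψ : ∀ x ∈ Set.Icc a b, HasDerivAt ψ (D x) x)
    (hD : ∀ x ∈ Set.Icc a b, HasDerivAt D (-(c / angDist β x ^ 2 * ψ x)) x) :
    HasProfile β c a b (ψ a) (ψ b) (D b * ψ b - D a * ψ a) := by
  have hW : ContinuousOn (fun x => c / angDist β x ^ 2) (Set.Icc a b) := by
    refine continuousOn_const.div ((continuous_angDist β).continuousOn.pow 2) fun x hx => ?_
    have := angDist_pos (ha.trans_le hx.1) (hx.2.trans_lt hb)
    positivity
  rw [← integral_energy_eq hab hψ hD hW]
  have h := hasProfile_of_hasDerivAt (c := c) ha hab hb hψ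
    fun x hx => (hD x hx).continuousAt.continuousWithinAt
  have e : ∀ x, D x ^ 2 - c / angDist β x ^ 2 * ψ x ^ 2
      = D x ^ 2 - c * (ψ x ^ 2 / angDist β x ^ 2) := fun x => by ring
  simpa only [e] using h

/-- A profile of negative energy vanishing at both ends violates the Hardy inequality. -/
lemma HasProfile.not_hardy (hβ : π ≤ β) (hβ2 : β ≤ 2 * π) (ha : 0 < a) (hab : a ≤ b) (hb : b < β)
    (h : HasProfile β c a b 0 0 E) (hE : E < 0) :
    ¬ ∀ u : EuclideanSpace ℝ (Fin 2) → ℝ,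
      ContDiff ℝ (⊤ : ℕ∞) u → HasCompactSupport u → tsupport u ⊆ sector β →
      c * ∫ x in sector β, u x ^ 2 / Metric.infDist x (sector β)ᶜ ^ 2
        ≤ ∫ x in sector β, ‖gradient u x‖ ^ 2 := by
  obtain ⟨p, ψ, hm, hM, hz, hi, -, h0, h1, he⟩ := h
  have I := intervalIntegrable_of_bounded_of_support hm hM hz
  obtain ⟨M, hM⟩ := hM
  have hz' : ∀ x ∉ Set.Icc a b, p x = 0 := fun x hx => hz x fun h => hx (Set.Ioc_subset_Icc_self h)
  have hzero : ∫ x, p x = 0 := by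
    have := hi b ⟨hab, le_rfl⟩
    rw [h0, h1, sub_zero, intervalIntegral.integral_of_le hab] at this
    rw [← this]
    exact (setIntegral_eq_integral_of_forall_compl_eq_zero hz).symm
  have z0 : ∀ x ≤ a, p x = 0 := fun x hx => hz x fun h => absurd h.1 (not_lt.2 hx)
  have int0 : ∫ t in (0)..a, p t = 0 := by
    refine (intervalIntegral.integral_congr fun t ht => ?_).trans intervalIntegral.integral_zero
    rw [Set.uIcc_of_le ha.le] at ht
    exact z0 t ht.2
  refine not_hardy_of_bounded_deriv hβ hβ2 ha hab hb hm hM hz' hzero ?_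
  refine lt_of_eq_of_lt ?_ hE
  rw [← he, intervalIntegral.integral_of_le hab]
  have hsub : Set.Ioc a b ⊆ Set.Ioo 0 β := fun x hx => ⟨ha.trans hx.1, hx.2.trans_lt hb⟩
  refine (setIntegral_eq_of_subset_of_forall_sdiff_eq_zero measurableSet_Ioo hsub
    fun x hx => ?_).trans ?_
  · rw [hz x hx.2]
    have : ∫ t in (0)..x, p t = 0 := by
      by_cases hxa : x = a
      · rw [hxa, int0]
      · refine primitive_eq_zero ha hz' hzero fun hm => hx.2 ⟨lt_of_le_of_ne hm.1 (Ne.symm hxa), hm.2⟩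
    rw [this]; simp
  · refine setIntegral_congr_fun measurableSet_Ioc fun x hx => ?_
    rw [← intervalIntegral.integral_add_adjacent_intervals (I 0 a) (I a x), int0, zero_add,
      hi x (Set.Ioc_subset_Icc_self hx), h0, sub_zero]

end Profile

lemma not_hardy_supercritical {β : ℝ} (hβ : π ≤ β) (hβ2 : β ≤ 2 * π)
    (htan : 2 * critSlope < tan ((β - π) / 4)) :
    ¬ ∀ u : EuclideanSpace ℝ (Fin 2) → ℝ,
      ContDiff ℝ (⊤ : ℕ∞) u → HasCompactSupport u → tsupport u ⊆ sector β →
      1 / 4 * ∫ x in sector β, u x ^ 2 / Metric.infDist x (sector β)ᶜ ^ 2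
        ≤ ∫ x in sector β, ‖gradient u x‖ ^ 2 := by
  have hpi := pi_pos
  obtain ⟨κ, hκ1, hκ2⟩ := exists_between (show critSlope < tan ((β - π) / 4) / 2 by linarith)
  obtain ⟨θ₀, h0, h1, hz⟩ := exists_angSol_eq_zero hκ1
  have hsin : ∀ x ∈ Set.Icc θ₀ (π / 2), 0 < sin x := fun x hx =>
    sin_pos_of_pos_of_lt_pi (h0.trans_le hx.1) (by linarith [hx.2])
  have hleft : HasProfile β (1 / 4) θ₀ (π / 2) 0 1 κ := by
    have h := hasProfile_of_ode (β := β) (c := 1 / 4) (ψ := angSol κ) (D := angSol' κ) h0 h1.le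
      (by linarith) (fun x hx => hasDerivAt_angSol κ (hsin x hx)) fun x hx => by
        refine (hasDerivAt_angSol' κ (hsin x hx)).congr_deriv ?_
        rw [angDist_of_le hβ hx.2]
        have := (hsin x hx).ne'
        field_simp
    rwa [hz, angSol_pi_div_two, angSol'_pi_div_two, mul_one, mul_zero, sub_zero] at h
  have hright : HasProfile β (1 / 4) (β - π / 2) (β - θ₀) 1 0 κ := by
    have hmem : ∀ x ∈ Set.Icc (β - π / 2) (β - θ₀), β - x ∈ Set.Icc θ₀ (π / 2) := fun x hx =>
      ⟨by linarith [hx.2], by linarith [hx.1]⟩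
    have hsub : ∀ x, HasDerivAt (fun y => β - y) (-1) x := fun x => (hasDerivAt_id x).const_sub β
    have h := hasProfile_of_ode (β := β) (c := 1 / 4) (a := β - π / 2) (b := β - θ₀)
      (ψ := fun x => angSol κ (β - x)) (D := fun x => -angSol' κ (β - x))
      (by linarith) (by linarith) (by linarith) (fun x hx =>
        ((hasDerivAt_angSol κ (hsin _ (hmem x hx))).comp x (hsub x)).congr_deriv (by ring))
      fun x hx => by
        refine ((hasDerivAt_angSol' κ (hsin _ (hmem x hx))).comp x (hsub x)).neg.congr_deriv ?_
        rw [angDist_of_ge hβ hx.1]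
        have := (hsin _ (hmem x hx)).ne'
        field_simp
    simp only [sub_sub_cancel] at h
    rwa [hz, angSol_pi_div_two, angSol'_pi_div_two, mul_one, mul_zero, zero_sub, neg_neg] at h
  have hmid : HasProfile β (1 / 4) (π / 2) (β - π / 2) 1 1 (-tan ((β - π) / 4)) := by
    have hc : 0 < cos ((β - π) / 4) := cos_pos_of_mem_Ioo ⟨by linarith, by linarith⟩
    have h := hasProfile_of_ode (β := β) (c := 1 / 4) (a := π / 2) (b := β - π / 2)
      (ψ := fun x => cos ((x - β / 2) / 2) / cos ((β - π) / 4))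
      (D := fun x => -(1 / 2) * sin ((x - β / 2) / 2) / cos ((β - π) / 4))
      (by linarith) (by linarith) (by linarith)
      (fun x _ => (hasDerivAt_midSol β x).div_const _)
      fun x hx => by
        refine ((hasDerivAt_midSol' β x).div_const _).congr_deriv ?_
        rw [angDist_of_mid hx.1 hx.2]
        ring
    have e1 : (β - π / 2 - β / 2) / 2 = (β - π) / 4 := by ring
    have e2 : (π / 2 - β / 2) / 2 = -((β - π) / 4) := by ring
    simp only [e1, e2, cos_neg, sin_neg, div_self hc.ne'] at h
    convert h using 1
    rw [tan_eq_sin_div_cos]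
    ring
  exact ((hleft.trans h1.le (by linarith) hmid).trans (by linarith) (by linarith) hright).not_hardy
    hβ hβ2 h0 (by linarith) (by linarith) (by linarith)

lemma hasDerivAt_sqrt_mul_sin_log (s : ℝ) {x : ℝ} (hx : 0 < x) :
    HasDerivAt (fun x => √x * sin (s * log x))
      (1 / √x * (1 / 2 * sin (s * log x) + s * cos (s * log x))) x := by
  have h1 := hasDerivAt_sqrt hx.ne'
  have h2 := ((hasDerivAt_log hx.ne').const_mul s).sin
  refine (h1.mul h2).congr_deriv ?_
  have hs : 0 < √x := Real.sqrt_pos.2 hx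
  have hxx : x = √x ^ 2 := (Real.sq_sqrt hx.le).symm
  have hinv : x⁻¹ = (√x)⁻¹ ^ 2 := by rw [inv_pow, ← hxx]
  rw [hinv]
  field_simp

lemma hasDerivAt_deriv_sqrt_mul_sin_log (s : ℝ) {x : ℝ} (hx : 0 < x) :
    HasDerivAt (fun x => 1 / √x * (1 / 2 * sin (s * log x) + s * cos (s * log x)))
      (-((1 / 4 + s ^ 2) / x ^ 2 * (√x * sin (s * log x)))) x := by
  have hs : 0 < √x := Real.sqrt_pos.2 hx
  have h1 := (hasDerivAt_const x (1 : ℝ)).div (hasDerivAt_sqrt hx.ne') hs.ne'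
  have h2 := ((hasDerivAt_log hx.ne').const_mul s)
  refine (h1.mul ((h2.sin.const_mul (1 / 2)).add (h2.cos.const_mul s))).congr_deriv ?_
  have hxx : x = √x ^ 2 := (Real.sq_sqrt hx.le).symm
  have hinv : x⁻¹ = (√x)⁻¹ ^ 2 := by rw [inv_pow, ← hxx]
  have hsq : x ^ 2 = √x ^ 4 := by nth_rw 1 [hxx]; ring
  rw [hinv, hsq]
  simp only [Pi.add_apply, Pi.div_apply]
  field_simp
  ring

/-- No constant above `1/4` is admissible. -/
lemma not_hardy_of_quarter_lt {β c : ℝ} (hβ : π ≤ β) (hβ2 : β ≤ 2 * π) (hc : 1 / 4 < c) :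
    ¬ ∀ u : EuclideanSpace ℝ (Fin 2) → ℝ,
      ContDiff ℝ (⊤ : ℕ∞) u → HasCompactSupport u → tsupport u ⊆ sector β →
      c * ∫ x in sector β, u x ^ 2 / Metric.infDist x (sector β)ᶜ ^ 2
        ≤ ∫ x in sector β, ‖gradient u x‖ ^ 2 := by
  have hpi := pi_gt_three
  set s := √(c - 1 / 4) with hsdef
  have hs : 0 < s := Real.sqrt_pos.2 (by linarith)
  have hcs : c = 1 / 4 + s ^ 2 := by rw [hsdef, Real.sq_sqrt (by linarith)]; ring
  set ψ : ℝ → ℝ := fun x => √x * sin (s * log x) with hψ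
  set D : ℝ → ℝ := fun x => 1 / √x * (1 / 2 * sin (s * log x) + s * cos (s * log x)) with hD
  set a := exp (-(2 * π / s)) with ha
  set b := exp (-(π / s)) with hb
  have ha0 : 0 < a := exp_pos _
  have hps : 0 < π / s := by positivity
  have hab : a < b := exp_lt_exp.2 (by rw [mul_div_assoc]; linarith)
  have hb1 : b < 1 := Real.exp_lt_one_iff.2 (by linarith)
  have hψa : ψ a = 0 := by
    have : s * log a = -(2 * π) := by rw [ha, log_exp]; field_simp
    simp only [hψ, this, sin_neg, sin_two_pi, neg_zero, mul_zero]
  have hψb : ψ b = 0 := by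
    have : s * log b = -π := by rw [hb, log_exp]; field_simp
    simp only [hψ, this, sin_neg, sin_pi, neg_zero, mul_zero]
  have hψD : ∀ x ∈ Set.Icc a b, HasDerivAt ψ (D x) x := fun x hx =>
    hasDerivAt_sqrt_mul_sin_log s (ha0.trans_le hx.1)
  have hDD : ∀ x ∈ Set.Icc a b, HasDerivAt D (-(c / x ^ 2 * ψ x)) x := fun x hx => by
    rw [hcs]; exact hasDerivAt_deriv_sqrt_mul_sin_log s (ha0.trans_le hx.1)
  have cW : ContinuousOn (fun x : ℝ => c / x ^ 2) (Set.Icc a b) :=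
    continuousOn_const.div (by fun_prop) fun x hx => (pow_pos (ha0.trans_le hx.1) 2).ne'
  have cD : ContinuousOn D (Set.Icc a b) := fun x hx => (hDD x hx).continuousAt.continuousWithinAt
  have cψ : ContinuousOn ψ (Set.Icc a b) := fun x hx => (hψD x hx).continuousAt.continuousWithinAt
  have hE0 := integral_energy_eq hab.le hψD hDD cW
  rw [hψa, hψb, mul_zero, mul_zero, sub_zero] at hE0
  have hprof := hasProfile_of_hasDerivAt (β := β) (c := c) ha0 hab.le (by linarith) hψD cD
  rw [hψa, hψb] at hprof
  refine hprof.not_hardy hβ hβ2 ha0 hab.le (by linarith) (lt_of_lt_of_eq ?_ hE0)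
  have hpos : ∀ x ∈ Set.Icc a b, 0 < sin x ∧ sin x < x ∧ angDist β x = sin x := fun x hx =>
    ⟨sin_pos_of_pos_of_lt_pi (ha0.trans_le hx.1) (by linarith [hx.2]),
      sin_lt (ha0.trans_le hx.1), angDist_of_le hβ (by linarith [hx.2])⟩
  refine intervalIntegral.integral_lt_integral_of_continuousOn_of_le_of_exists_lt hab
    (continuousOn_energy ha0 (by linarith) hψD cD) ((cD.pow 2).sub (cW.mul (cψ.pow 2)))
    (fun x hx => ?_) ⟨exp (-(3 * π / (2 * s))), ⟨?_, ?_⟩, ?_⟩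
  · obtain ⟨h1, h2, h3⟩ := hpos x (Set.Ioc_subset_Icc_self hx)
    rw [h3, div_mul_eq_mul_div, mul_div_assoc]
    gcongr
  · refine exp_le_exp.2 ?_
    have : 2 * π / s = 2 * (π / s) := by ring
    have : 3 * π / (2 * s) = 3 / 2 * (π / s) := by field_simp
    linarith
  · refine exp_le_exp.2 ?_
    have : 3 * π / (2 * s) = 3 / 2 * (π / s) := by field_simp
    linarith
  · set x := exp (-(3 * π / (2 * s))) with hx
    have hmem : x ∈ Set.Icc a b := by
      have e1 : 2 * π / s = 2 * (π / s) := by ring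
      have e2 : 3 * π / (2 * s) = 3 / 2 * (π / s) := by field_simp
      exact ⟨exp_le_exp.2 (by linarith), exp_le_exp.2 (by linarith)⟩
    obtain ⟨h1, h2, h3⟩ := hpos x hmem
    have hψx : 0 < ψ x := by
      have e : s * log x = π / 2 - 2 * π := by rw [hx, log_exp]; field_simp; ring
      simp only [hψ, e, sin_sub_two_pi, sin_pi_div_two, mul_one]
      exact Real.sqrt_pos.2 (exp_pos _)
    rw [h3, div_mul_eq_mul_div, mul_div_assoc]
    have : ψ x ^ 2 / x ^ 2 < ψ x ^ 2 / sin x ^ 2 := by gcongr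
    have := mul_lt_mul_of_pos_left this (show 0 < c by linarith)
    linarith

lemma hardyConst_critical {β : ℝ} (hβ : π ≤ β) (hβ2 : β ≤ 2 * π)
    (htan : tan ((β - π) / 4) = 2 * critSlope) : hardyConst (sector β) = 1 / 4 := by
  refine IsGreatest.csSup_eq ⟨⟨by norm_num, fun u hu hc hs => hardy_critical hβ hβ2 htan hu hc hs⟩,
    fun c hc => ?_⟩
  by_contra hlt
  exact not_hardy_of_quarter_lt hβ hβ2 (not_le.1 hlt) hc.2

lemma hardyConst_supercritical {β : ℝ} (hβ : π ≤ β) (hβ2 : β ≤ 2 * π)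
    (htan : 2 * critSlope < tan ((β - π) / 4)) : hardyConst (sector β) ≠ 1 / 4 := by
  intro h
  refine not_hardy_supercritical hβ hβ2 htan fun u hu hc hs => ?_
  by_contra hlt
  rw [not_le] at hlt
  set I := ∫ x in sector β, u x ^ 2 / Metric.infDist x (sector β)ᶜ ^ 2 with hI
  set J := ∫ x in sector β, ‖gradient u x‖ ^ 2 with hJ
  have hJ0 : 0 ≤ J := integral_nonneg fun x => sq_nonneg _
  have hI0 : 0 < I := by linarith
  have hlt' : J / I < hardyConst (sector β) := by
    rw [h, div_lt_iff₀ hI0]; exact hlt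
  unfold hardyConst at hlt' h
  rcases Set.eq_empty_or_nonempty {c : ℝ | 0 ≤ c ∧ ∀ u : EuclideanSpace ℝ (Fin 2) → ℝ,
    ContDiff ℝ (⊤ : ℕ∞) u → HasCompactSupport u → tsupport u ⊆ sector β →
    c * ∫ x in sector β, u x ^ 2 / Metric.infDist x (sector β)ᶜ ^ 2
      ≤ ∫ x in sector β, ‖gradient u x‖ ^ 2} with he | hne
  · rw [he, Real.sSup_empty] at h
    norm_num at h
  · obtain ⟨c, hcm, hcI⟩ := exists_lt_of_lt_csSup hne hlt'
    rw [div_lt_iff₀ hI0] at hcI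
    exact absurd (hcm.2 u hu hc hs) (not_le.2 hcI)

/-- **The critical angle via the Gamma function (Barbatis–Tertikas).**
The critical angle `β_cr = sup{β ∈ [π, 2π] : H(Λ_β) = 1/4}` lies in `(π, 2π)` and is the
unique solution there of `tan((β − π)/4) = 4 (Γ(3/4)/Γ(1/4))²`. -/
theorem critical_angle_equation
    (βcr : ℝ)
    (hdef : βcr = sSup {β : ℝ | β ∈ Set.Icc Real.pi (2 * Real.pi) ∧
      hardyConst (sector β) = 1 / 4}) :
    βcr ∈ Set.Ioo Real.pi (2 * Real.pi) ∧
    Real.tan ((βcr - Real.pi) / 4)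
      = 4 * (Real.Gamma (3 / 4) / Real.Gamma (1 / 4)) ^ 2 ∧
    ∀ β ∈ Set.Ioo Real.pi (2 * Real.pi),
      Real.tan ((β - Real.pi) / 4) = 4 * (Real.Gamma (3 / 4) / Real.Gamma (1 / 4)) ^ 2 →
      β = βcr := by
  have hpi := pi_pos
  have hcs := critSlope_pos
  have hcs' := critSlope_le
  have hR : 4 * (Real.Gamma (3 / 4) / Real.Gamma (1 / 4)) ^ 2 = 2 * critSlope := by
    rw [critSlope]; ring
  rw [hR]
  set B := π + 4 * arctan (2 * critSlope) with hB
  have hBsub : (B - π) / 4 = arctan (2 * critSlope) := by rw [hB]; ring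
  have htanB : tan ((B - π) / 4) = 2 * critSlope := by rw [hBsub, tan_arctan]
  have h1 : 0 < arctan (2 * critSlope) := arctan_pos.2 (by linarith)
  have h2 : arctan (2 * critSlope) < π / 4 := by
    rw [← arctan_one]; exact arctan_strictMono (by linarith)
  have hBπ : π < B := by linarith
  have hB2 : B < 2 * π := by linarith
  have hinj : ∀ β, π ≤ β → β ≤ 2 * π → (β - π) / 4 ∈ Set.Ioo (-(π / 2)) (π / 2) :=
    fun β h h' => ⟨by linarith, by linarith⟩
  have hcr : βcr = B := by
    rw [hdef]
    refine IsGreatest.csSup_eq ⟨⟨⟨hBπ.le, hB2.le⟩, hardyConst_critical hBπ.le hB2.le htanB⟩,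
      fun β hβ => ?_⟩
    by_contra hlt
    rw [not_le] at hlt
    refine hardyConst_supercritical hβ.1.1 hβ.1.2 ?_ hβ.2
    rw [← htanB]
    exact strictMonoOn_tan (hinj B hBπ.le hB2.le) (hinj β hβ.1.1 hβ.1.2) (by linarith)
  rw [hcr]
  refine ⟨⟨hBπ, hB2⟩, htanB, fun β hβ h => ?_⟩
  have := strictMonoOn_tan.injOn (hinj β hβ.1.le hβ.2.le) (hinj B hBπ.le hB2.le)
    (h.trans htanB.symm)
  linarith
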